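/- arXiv:2504.18739 — 4 statements merged into one kernel-verified Lean document; each statement's English description precedes it below -/
import Mathlib

section
/- Let d ≥ 1. For every x ∈ ℝ^d the limit Ψ(x) = lim_{t→0⁺} P_t(x)/H_t(x) exists. Moreover, for 1 < p < ∞ and every compactly supported f : ℤ^d → ℝ, the function f_ext(x) = Σ_{m ∈ ℤ^d} f(m) Ψ(x − m) satisfies ‖f_ext‖_{L^p(ℝ^d)} ≤ ‖f‖_{ℓ^p(ℤ^d)} and f_ext(n) = f(n) for all n ∈ ℤ^d. -/
open MeasureTheory Real Filter

noncomputable section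

/-- The lattice ℤ^d. -/
abbrev ZLat (d : ℕ) := Fin d → ℤ

/-- Embedding of the lattice ℤ^d into Euclidean space ℝ^d. -/
def latVec {d : ℕ} (m : ZLat d) : EuclideanSpace ℝ (Fin d) := WithLp.toLp 2 fun i => (m i : ℝ)

/-- The (Gaussian) heat kernel on ℝ^d. -/
def heatK (d : ℕ) (t : ℝ) (x : EuclideanSpace ℝ (Fin d)) : ℝ :=
  (2 * π * t) ^ (-(d : ℝ) / 2) * Real.exp (-‖x‖ ^ 2 / (2 * t))

/-- The periodic heat kernel H_t(x) = Σ_{n ∈ ℤ^d} P_t(x − n). -/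
def pHeatK (d : ℕ) (t : ℝ) (x : EuclideanSpace ℝ (Fin d)) : ℝ :=
  ∑' n : ZLat d, heatK d t (x - latVec n)

/-- Partial derivative in the j-th coordinate direction. -/
def pderiv {d : ℕ} (j : Fin d) (f : EuclideanSpace ℝ (Fin d) → ℝ)
    (x : EuclideanSpace ℝ (Fin d)) : ℝ :=
  fderiv ℝ f x (EuclideanSpace.single j 1)

/-- The constant c_d = π^{-d/2} Γ((d+2)/2). -/
def cConst (d : ℕ) : ℝ := π ^ (-(d : ℝ) / 2) * Real.Gamma (((d : ℝ) + 2) / 2)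

/-- The discrete second-order Riesz kernel K_dis^{(jk)}. -/
def discK (d : ℕ) (j k : Fin d) (m : ZLat d) : ℝ :=
  if m = 0 then 0 else cConst d * (m j : ℝ) * (m k : ℝ) / ‖latVec m‖ ^ (d + 2)

/-- The discrete second-order Riesz transform R_dis^{(jk)}. -/
def Rdis (d : ℕ) (j k : Fin d) (f : ZLat d → ℝ) (n : ZLat d) : ℝ :=
  ∑' m : ZLat d, discK d j k m * f (n - m)

/-- The probabilistic kernel 𝒦^{(jk)}(m). -/
def probK (d : ℕ) (j k : Fin d) (m : ZLat d) : ℝ :=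
  -∫ s in Set.Ioi (0 : ℝ), ∫ x : EuclideanSpace ℝ (Fin d),
      pHeatK d s x *
        (pderiv j (fun y => heatK d s y / pHeatK d s y) x *
         pderiv k (fun y => heatK d s (y - latVec m) / pHeatK d s y) x)

/-- The probabilistic discrete second-order Riesz transform 𝓡^{(jk)}. -/
def Rprob (d : ℕ) (j k : Fin d) (f : ZLat d → ℝ) (n : ZLat d) : ℝ :=
  ∑' m : ZLat d, probK d j k (n - m) * f m

/-- The ℓ^p norm of f : ℤ^d → ℝ. -/
def lpN (d : ℕ) (p : ℝ) (f : ZLat d → ℝ) : ℝ := (∑' n : ZLat d, |f n| ^ p) ^ (1 / p)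

/-- Membership in ℓ^p(ℤ^d). -/
def MemLpLat (d : ℕ) (p : ℝ) (f : ZLat d → ℝ) : Prop := Summable fun n : ZLat d => |f n| ^ p

/-- Operator norm of an operator on ℓ^p(ℤ^d): sup of ‖Tf‖ over ‖f‖ = 1. -/
def opN (d : ℕ) (p : ℝ) (T : (ZLat d → ℝ) → (ZLat d → ℝ)) : ℝ :=
  sSup {c : ℝ | ∃ f : ZLat d → ℝ, MemLpLat d p f ∧ lpN d p f = 1 ∧ c = lpN d p (T f)}

/-- p* = max{p, p/(p-1)}. -/
def pstar (p : ℝ) : ℝ := max p (p / (p - 1))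



lemma aux_int_summable : Summable (fun n : ℤ => Real.exp (-|(n:ℝ)|)) := by
  apply Summable.of_nat_of_neg
  · simpa using Real.summable_exp_neg_nat
  · simpa using Real.summable_exp_neg_nat

lemma aux_1d (c x : ℝ) (hc : 0 < c) : Summable (fun n : ℤ => Real.exp (-(c * (x - n) ^ 2))) := by
  refine Summable.of_nonneg_of_le (fun n => (Real.exp_pos _).le) (fun n => ?_)
    (aux_int_summable.mul_left (Real.exp (|x| + 1 / (4 * c))))
  rw [← Real.exp_add]
  apply Real.exp_le_exp.mpr
  have h1 : |(n:ℝ)| ≤ |x| + |x - n| := by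
    have := abs_sub_abs_le_abs_sub (n:ℝ) x
    rw [abs_sub_comm] at this; linarith
  have h2 : |x - n| ≤ c * (x - n) ^ 2 + 1 / (4 * c) := by
    rw [← sq_abs (x - n)]
    have : c * |x - n| ^ 2 + 1 / (4 * c) - |x - n| = c * (|x - n| - 1 / (2 * c)) ^ 2 := by
      field_simp; ring
    nlinarith [mul_nonneg hc.le (sq_nonneg (|x - n| - 1 / (2 * c)))]
  linarith

lemma aux_prod {d : ℕ} (g : Fin d → ℤ → ℝ) (h0 : ∀ i n, 0 ≤ g i n) (hs : ∀ i, Summable (g i)) :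
    Summable (fun n : ZLat d => ∏ i, g i (n i)) := by
  classical
  refine summable_of_sum_le (c := ∏ i, ∑' n, g i n)
    (fun n => Finset.prod_nonneg fun i _ => h0 i _) (fun S => ?_)
  calc ∑ n ∈ S, ∏ i, g i (n i)
      ≤ ∑ n ∈ Fintype.piFinset (fun i => S.image (fun n => n i)), ∏ i, g i (n i) := by
        apply Finset.sum_le_sum_of_subset_of_nonneg
        · intro n hn
          rw [Fintype.mem_piFinset]
          exact fun i => Finset.mem_image_of_mem _ hn
        · exact fun n _ _ => Finset.prod_nonneg fun i _ => h0 i _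
    _ = ∏ i, ∑ k ∈ S.image (fun n => n i), g i k := (Finset.prod_univ_sum _ _).symm
    _ ≤ _ := Finset.prod_le_prod (fun i _ => Finset.sum_nonneg fun k _ => h0 i k)
        (fun i _ => (hs i).sum_le_tsum _ (fun k _ => h0 i k))

lemma aux_gauss {d : ℕ} (t : ℝ) (ht : 0 < t) (x : EuclideanSpace ℝ (Fin d)) :
    Summable (fun n : ZLat d => Real.exp (-‖x - latVec n‖ ^ 2 / (2 * t))) := by
  have := aux_prod (fun (i : Fin d) (n : ℤ) => Real.exp (-(1 / (2 * t) * (x i - n) ^ 2)))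
    (fun _ _ => (Real.exp_pos _).le) (fun i => aux_1d _ _ (by positivity))
  refine this.congr (fun n => ?_)
  rw [← Real.exp_sum, EuclideanSpace.norm_sq_eq]
  congr 1
  simp only [latVec, PiLp.sub_apply, Real.norm_eq_abs, sq_abs]
  rw [Finset.sum_neg_distrib, ← Finset.mul_sum]
  ring

lemma heatK_pos {d : ℕ} {t : ℝ} (ht : 0 < t) (x : EuclideanSpace ℝ (Fin d)) :
    0 < heatK d t x := by
  unfold heatK; positivity

lemma heatK_summable {d : ℕ} {t : ℝ} (ht : 0 < t) (x : EuclideanSpace ℝ (Fin d)) :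
    Summable (fun n : ZLat d => heatK d t (x - latVec n)) :=
  (aux_gauss t ht x).mul_left _

lemma heatK_le {d : ℕ} {t : ℝ} (ht : 0 < t) (x : EuclideanSpace ℝ (Fin d)) (n : ZLat d) :
    heatK d t (x - latVec n) ≤ pHeatK d t x :=
  (heatK_summable ht x).le_tsum n (fun _ _ => (heatK_pos ht _).le)

lemma latVec_add {d : ℕ} (m n : ZLat d) : latVec (m + n) = latVec m + latVec n := by
  ext i; simp [latVec]

lemma latVec_zero {d : ℕ} : latVec (0 : ZLat d) = 0 := by
  ext i; simp [latVec]

lemma latVec_sub {d : ℕ} (m n : ZLat d) : latVec (m - n) = latVec m - latVec n := by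
  ext i; simp [latVec]

lemma latVec_eq_zero {d : ℕ} {m : ZLat d} (h : latVec m = 0) : m = 0 := by
  funext i
  have := congrArg (fun v : EuclideanSpace ℝ (Fin d) => v i) h
  simpa [latVec] using this

lemma pHeatK_pos {d : ℕ} {t : ℝ} (ht : 0 < t) (x : EuclideanSpace ℝ (Fin d)) :
    0 < pHeatK d t x := lt_of_lt_of_le (heatK_pos ht _) (heatK_le ht x 0)

lemma pHeatK_periodic {d : ℕ} (t : ℝ) (x : EuclideanSpace ℝ (Fin d)) (m : ZLat d) :
    pHeatK d t (x - latVec m) = pHeatK d t x := by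
  unfold pHeatK
  rw [← (Equiv.addLeft m).tsum_eq (fun n => heatK d t (x - latVec n))]
  congr 1; funext n
  simp only [Equiv.coe_addLeft, latVec_add, sub_sub]

lemma heatK_shift {d : ℕ} (t : ℝ) (x y : EuclideanSpace ℝ (Fin d)) :
    heatK d t y = heatK d t x * Real.exp (-(‖y‖ ^ 2 - ‖x‖ ^ 2) / (2 * t)) := by
  unfold heatK
  rw [mul_assoc ((2 * π * t) ^ (-(d : ℝ) / 2)), ← Real.exp_add]; congr 2; ring

open Classical in
def PsiF (d : ℕ) (x : EuclideanSpace ℝ (Fin d)) : ℝ :=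
  if ∃ n : ZLat d, ‖x - latVec n‖ < ‖x‖ then 0
  else (∑' n : ZLat d, if ‖x - latVec n‖ = ‖x‖ then (1:ℝ) else 0)⁻¹

lemma tendsto_exp_aux {a : ℝ} (ha : 0 < a) :
    Tendsto (fun t : ℝ => Real.exp (-a / (2 * t))) (nhdsWithin 0 (Set.Ioi 0)) (nhds 0) := by
  apply Real.tendsto_exp_atBot.comp
  have : (fun t : ℝ => -a / (2 * t)) = fun t => (-a / 2) * t⁻¹ := by
    funext t; rw [mul_comm 2 t, ← div_div, div_right_comm, div_eq_mul_inv]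
  rw [this]
  exact tendsto_inv_nhdsGT_zero.const_mul_atTop_of_neg (by linarith)

lemma Psi_tendsto (d : ℕ) (x : EuclideanSpace ℝ (Fin d)) :
    Tendsto (fun t : ℝ => heatK d t x / pHeatK d t x)
          (nhdsWithin 0 (Set.Ioi 0)) (nhds (PsiF d x)) := by
  classical
  unfold PsiF
  split_ifs with h
  · obtain ⟨n, hn⟩ := h
    have ha : 0 < ‖x‖ ^ 2 - ‖x - latVec n‖ ^ 2 := by
      nlinarith [norm_nonneg (x - latVec n)]
    refine tendsto_of_tendsto_of_tendsto_of_le_of_le' tendsto_const_nhds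
      (tendsto_exp_aux ha) ?_ ?_
    · filter_upwards [self_mem_nhdsWithin] with t ht
      exact div_nonneg (heatK_pos ht _).le (pHeatK_pos ht _).le
    · filter_upwards [self_mem_nhdsWithin] with t ht
      rw [div_le_iff₀ (pHeatK_pos ht _), heatK_shift t (x - latVec n) x, mul_comm]
      exact mul_le_mul_of_nonneg_left (heatK_le ht x n) (Real.exp_pos _).le
  · push Not at h
    have ha : ∀ n : ZLat d, 0 ≤ ‖x - latVec n‖ ^ 2 - ‖x‖ ^ 2 := fun n => by
      nlinarith [norm_nonneg x, h n]
    have key : Tendsto (fun t : ℝ => ∑' n : ZLat d,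
        Real.exp (-(‖x - latVec n‖ ^ 2 - ‖x‖ ^ 2) / (2 * t))) (nhdsWithin 0 (Set.Ioi 0))
        (nhds (∑' n : ZLat d, if ‖x - latVec n‖ = ‖x‖ then (1:ℝ) else 0)) := by
      refine tendsto_tsum_of_dominated_convergence
        (bound := fun n => Real.exp (-(‖x - latVec n‖ ^ 2 - ‖x‖ ^ 2) / (2 * 1))) ?_ ?_ ?_
      · refine ((aux_gauss 1 one_pos x).mul_left (Real.exp (‖x‖ ^ 2 / 2))).congr (fun n => ?_)
        rw [← Real.exp_add]; congr 1; ring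
      · intro n
        split_ifs with hn
        · simp [hn]
        · apply tendsto_exp_aux
          have := lt_of_le_of_ne (h n) (Ne.symm hn)
          nlinarith [norm_nonneg x]
      · have h1 : Set.Ioo (0:ℝ) 1 ∈ nhdsWithin (0:ℝ) (Set.Ioi 0) := Ioo_mem_nhdsGT one_pos
        filter_upwards [h1] with t ht n
        rw [Real.norm_eq_abs, Real.abs_exp]
        apply Real.exp_le_exp.mpr
        rw [neg_div, neg_div, neg_le_neg_iff]
        have := ht.1
        have := ht.2
        apply div_le_div_of_nonneg_left (ha n) (by linarith) (by linarith)
    have hsum : Summable (fun n : ZLat d => if ‖x - latVec n‖ = ‖x‖ then (1:ℝ) else 0) := by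
      refine Summable.of_nonneg_of_le (fun n => by split_ifs <;> simp) (fun n => ?_)
        ((aux_gauss 1 one_pos x).mul_left (Real.exp (‖x‖ ^ 2 / 2)))
      split_ifs with hn
      · rw [hn, ← Real.exp_add]; apply le_of_eq; symm; rw [Real.exp_eq_one_iff]; ring
      · positivity
    have hpos : (1:ℝ) ≤ ∑' n : ZLat d, if ‖x - latVec n‖ = ‖x‖ then (1:ℝ) else 0 := by
      have := hsum.le_tsum (0 : ZLat d) (fun n _ => by split_ifs <;> simp)
      simpa [latVec_zero] using this
    refine (key.inv₀ (by linarith)).congr' ?_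
    filter_upwards [self_mem_nhdsWithin] with t ht
    have : pHeatK d t x = heatK d t x * ∑' n : ZLat d,
        Real.exp (-(‖x - latVec n‖ ^ 2 - ‖x‖ ^ 2) / (2 * t)) := by
      rw [← tsum_mul_left]
      exact tsum_congr fun n => heatK_shift t x _
    rw [this, div_mul_eq_div_div, div_self (heatK_pos ht _).ne', one_div]

lemma Psi_nonneg (d : ℕ) (x : EuclideanSpace ℝ (Fin d)) : 0 ≤ PsiF d x := by
  apply ge_of_tendsto (Psi_tendsto d x)
  filter_upwards [self_mem_nhdsWithin] with t ht
  exact div_nonneg (heatK_pos ht _).le (pHeatK_pos ht _).le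

lemma Psi_sum (d : ℕ) (x : EuclideanSpace ℝ (Fin d)) (S : Finset (ZLat d)) :
    ∑ m ∈ S, PsiF d (x - latVec m) ≤ 1 := by
  apply le_of_tendsto (tendsto_finsetSum S fun m _ => Psi_tendsto d (x - latVec m))
  filter_upwards [self_mem_nhdsWithin] with t ht
  simp only [pHeatK_periodic]
  rw [← Finset.sum_div, div_le_one (pHeatK_pos ht _)]
  exact (heatK_summable ht x).sum_le_tsum S (fun _ _ => (heatK_pos ht _).le)

lemma Psi_zero (d : ℕ) : PsiF d 0 = 1 := by
  classical
  unfold PsiF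
  rw [if_neg (by simp), tsum_eq_single 0]
  · simp [latVec_zero]
  · intro n hn
    rw [if_neg]
    simp only [zero_sub, norm_neg, norm_zero, norm_eq_zero]
    exact fun h => hn (latVec_eq_zero h)

lemma Psi_lat (d : ℕ) (m : ZLat d) (hm : m ≠ 0) : PsiF d (latVec m) = 0 := by
  have h : ‖latVec m - latVec m‖ < ‖latVec m‖ := by
    rw [sub_self, norm_zero, norm_pos_iff]
    exact fun h => hm (latVec_eq_zero h)
  unfold PsiF
  exact if_pos ⟨m, h⟩

lemma heatK_meas (d : ℕ) (t : ℝ) : Measurable (heatK d t) := by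
  unfold heatK; fun_prop

lemma pHeatK_meas (d : ℕ) {t : ℝ} (ht : 0 < t) : Measurable (pHeatK d t) := by
  refine measurable_of_tendsto_metrizable' (atTop : Filter (Finset (ZLat d)))
    (f := fun S x => ∑ n ∈ S, heatK d t (x - latVec n)) (fun S => ?_) ?_
  · exact Finset.measurable_sum S fun n _ => (heatK_meas d t).comp (measurable_id.sub_const _)
  · rw [tendsto_pi_nhds]
    exact fun x => (heatK_summable ht x).hasSum

lemma Psi_meas (d : ℕ) : Measurable (PsiF d) := by
  refine measurable_of_tendsto_metrizable (f := fun (k : ℕ) x =>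
    heatK d (1 / ((k:ℝ) + 1)) x / pHeatK d (1 / ((k:ℝ) + 1)) x) (fun k => ?_) ?_
  · exact (heatK_meas d _).div (pHeatK_meas d (by positivity))
  · rw [tendsto_pi_nhds]
    intro x
    refine (Psi_tendsto d x).comp ?_
    rw [tendsto_nhdsWithin_iff]
    exact ⟨tendsto_one_div_add_atTop_nhds_zero_nat,
      Eventually.of_forall fun k => by simp only [Set.mem_Ioi]; positivity⟩

def cellC {d : ℕ} (m : ZLat d) : Set (EuclideanSpace ℝ (Fin d)) := {x | ∀ i, ⌊x i⌋ = m i}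

lemma cellC_meas {d : ℕ} (m : ZLat d) : MeasurableSet (cellC m) := by
  have : cellC m = ⋂ i, (fun x : EuclideanSpace ℝ (Fin d) => ⌊x i⌋) ⁻¹' {m i} := by
    ext x; simp [cellC]
  rw [this]
  refine MeasurableSet.iInter fun i => ?_
  have hm : Measurable (fun x : EuclideanSpace ℝ (Fin d) => ⌊x i⌋) :=
    Int.measurable_floor.comp (by fun_prop)
  exact hm (measurableSet_singleton _)

lemma cellC_vol {d : ℕ} : volume (cellC (0 : ZLat d)) = 1 := by
  have h := (EuclideanSpace.volume_preserving_symm_measurableEquiv_toLp (Fin d)).symm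
  have h2 := h.measure_preimage (cellC_meas (0 : ZLat d)).nullMeasurableSet
  rw [← h2]
  have : (MeasurableEquiv.toLp 2 (Fin d → ℝ)).symm.symm ⁻¹' (cellC (0 : ZLat d))
      = Set.pi Set.univ (fun _ => Set.Ico (0:ℝ) 1) := by
    ext x
    simp [cellC, Int.floor_eq_zero_iff, Set.mem_pi]
  rw [this, volume_pi_pi]
  simp

lemma Psi_lintegral (d : ℕ) : ∫⁻ x, ENNReal.ofReal (PsiF d x) ≤ 1 := by
  have hcov : (⋃ m : ZLat d, cellC m) = Set.univ := by
    ext x; simp only [Set.mem_iUnion, Set.mem_univ, iff_true]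
    exact ⟨fun i => ⌊x i⌋, fun i => rfl⟩
  have hdisj : Pairwise (Function.onFun Disjoint (cellC : ZLat d → _)) := by
    intro m n hmn
    refine Set.disjoint_left.mpr fun x hx hy => hmn ?_
    funext i; rw [← hx i, ← hy i]
  have hmeas : Measurable (fun x => ENNReal.ofReal (PsiF d x)) := (Psi_meas d).ennreal_ofReal
  have hm2 : ∀ m : ZLat d, Measurable (fun x => ENNReal.ofReal (PsiF d (x - latVec m))) :=
    fun m => hmeas.comp (measurable_id.sub_const _)
  rw [← setLIntegral_univ, ← hcov, lintegral_iUnion cellC_meas hdisj]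
  have hshift : ∀ m : ZLat d, ∫⁻ x in cellC m, ENNReal.ofReal (PsiF d x)
      = ∫⁻ x in cellC (0 : ZLat d), ENNReal.ofReal (PsiF d (x + latVec m)) := by
    intro m
    rw [← lintegral_indicator (cellC_meas m), ← lintegral_indicator (cellC_meas 0),
      ← lintegral_add_right_eq_self _ (latVec m)]
    congr 1; funext x
    have : x + latVec m ∈ cellC m ↔ x ∈ cellC (0 : ZLat d) := by
      simp [cellC, latVec]
    by_cases hx : x ∈ cellC (0 : ZLat d)
    · rw [Set.indicator_of_mem (this.mpr hx), Set.indicator_of_mem hx]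
    · rw [Set.indicator_of_notMem (fun h => hx (this.mp h)), Set.indicator_of_notMem hx]
  simp only [hshift]
  rw [← (Equiv.neg (ZLat d)).tsum_eq]
  have hneg : ∀ m : ZLat d, ∀ x, x + latVec (-m) = x - latVec m := fun m x => by
    ext i; simp [latVec, sub_eq_add_neg]
  simp only [Equiv.neg_apply, hneg]
  rw [← lintegral_tsum fun m => (hm2 m).aemeasurable]
  calc _ ≤ ∫⁻ x in cellC (0 : ZLat d), 1 := by
        apply lintegral_mono
        intro x
        beta_reduce
        rw [ENNReal.tsum_eq_iSup_sum]
        refine iSup_le fun S => ?_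
        rw [← ENNReal.ofReal_sum_of_nonneg fun m _ => Psi_nonneg d _]
        exact ENNReal.ofReal_le_one.mpr (Psi_sum d x S)
    _ = 1 := by simp [cellC_vol]

lemma Psi_integrable (d : ℕ) : Integrable (PsiF d) := by
  refine ⟨(Psi_meas d).aestronglyMeasurable, ?_⟩
  rw [hasFiniteIntegral_iff_ofReal (Eventually.of_forall (Psi_nonneg d))]
  exact lt_of_le_of_lt (Psi_lintegral d) ENNReal.one_lt_top

lemma Psi_integral (d : ℕ) : ∫ x, PsiF d x ≤ 1 := by
  rw [integral_eq_lintegral_of_nonneg_ae (Eventually.of_forall (Psi_nonneg d))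
    (Psi_meas d).aestronglyMeasurable]
  exact ENNReal.toReal_le_of_le_ofReal zero_le_one (by simpa using Psi_lintegral d)

lemma jensen_aux {ι : Type*} (S : Finset ι) (p : ℝ) (hp : 1 < p) (w f : ι → ℝ)
    (hw : ∀ i, 0 ≤ w i) (hs : ∑ i ∈ S, w i ≤ 1) :
    |∑ i ∈ S, f i * w i| ^ p ≤ ∑ i ∈ S, |f i| ^ p * w i := by
  have h0 : 0 ≤ ∑ i ∈ S, w i * |f i| ^ p :=
    Finset.sum_nonneg fun i _ => mul_nonneg (hw i) (by positivity)
  have h1 : |∑ i ∈ S, f i * w i| ≤ (∑ i ∈ S, w i * |f i| ^ p) ^ p⁻¹ := by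
    calc |∑ i ∈ S, f i * w i| ≤ ∑ i ∈ S, w i * |f i| := by
          refine (Finset.abs_sum_le_sum_abs _ _).trans_eq (Finset.sum_congr rfl fun i _ => ?_)
          rw [abs_mul, abs_of_nonneg (hw i), mul_comm]
      _ ≤ (∑ i ∈ S, w i) ^ (1 - p⁻¹) * (∑ i ∈ S, w i * |f i| ^ p) ^ p⁻¹ :=
          Real.inner_le_weight_mul_Lp_of_nonneg S hp.le w (fun i => |f i|) hw
            (fun i => abs_nonneg _)
      _ ≤ 1 * _ := by
          gcongr
          exact Real.rpow_le_one (Finset.sum_nonneg fun i _ => hw i) hs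
            (sub_nonneg.mpr (inv_le_one_of_one_le₀ hp.le))
      _ = _ := one_mul _
  calc _ ≤ ((∑ i ∈ S, w i * |f i| ^ p) ^ p⁻¹) ^ p :=
        Real.rpow_le_rpow (abs_nonneg _) h1 (by linarith)
    _ = _ := by
        rw [Real.rpow_inv_rpow h0 (by linarith)]
        exact Finset.sum_congr rfl fun i _ => mul_comm _ _

theorem stmt5 (d : ℕ) (hd : 1 ≤ d) :
    ∃ Ψ : EuclideanSpace ℝ (Fin d) → ℝ,
      (∀ x : EuclideanSpace ℝ (Fin d),
        Filter.Tendsto (fun t : ℝ => heatK d t x / pHeatK d t x)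
          (nhdsWithin 0 (Set.Ioi 0)) (nhds (Ψ x))) ∧
      ∀ (p : ℝ), 1 < p → ∀ f : ZLat d → ℝ, (Function.support f).Finite →
        ((∫ x : EuclideanSpace ℝ (Fin d),
            |∑' m : ZLat d, f m * Ψ (x - latVec m)| ^ p) ^ (1 / p) ≤ lpN d p f) ∧
        (∀ n : ZLat d, (∑' m : ZLat d, f m * Ψ (latVec n - latVec m)) = f n) := by
  refine ⟨PsiF d, Psi_tendsto d, fun p hp f hf => ⟨?_, fun n => ?_⟩⟩
  · have hout : ∀ m, m ∉ hf.toFinset → f m = 0 := fun m hm => by simpa using hm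
    have hsum : ∀ x : EuclideanSpace ℝ (Fin d), ∑' m : ZLat d, f m * PsiF d (x - latVec m)
        = ∑ m ∈ hf.toFinset, f m * PsiF d (x - latVec m) := fun x =>
      tsum_eq_sum fun m hm => by rw [hout m hm, zero_mul]
    have hl : ∑' m : ZLat d, |f m| ^ p = ∑ m ∈ hf.toFinset, |f m| ^ p :=
      tsum_eq_sum fun m hm => by
        rw [hout m hm, abs_zero, Real.zero_rpow (by linarith)]
    unfold lpN
    rw [hl]
    apply Real.rpow_le_rpow (integral_nonneg fun x => by positivity) _ (by positivity)
    simp only [hsum]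
    have hint : ∀ m : ZLat d, Integrable (fun x => |f m| ^ p * PsiF d (x - latVec m)) :=
      fun m => ((Psi_integrable d).comp_sub_right (latVec m)).const_mul _
    calc _ ≤ ∫ x, ∑ m ∈ hf.toFinset, |f m| ^ p * PsiF d (x - latVec m) := by
          refine integral_mono_of_nonneg (Eventually.of_forall fun x => by positivity)
            (integrable_finsetSum _ fun m _ => hint m) (Eventually.of_forall fun x => ?_)
          exact jensen_aux _ p hp _ f (fun m => Psi_nonneg d _) (Psi_sum d x _)
      _ = ∑ m ∈ hf.toFinset, |f m| ^ p * ∫ x, PsiF d x := by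
          rw [integral_finsetSum _ fun m _ => hint m]
          refine Finset.sum_congr rfl fun m _ => ?_
          rw [integral_const_mul, integral_sub_right_eq_self (PsiF d)]
      _ ≤ _ := Finset.sum_le_sum fun m _ =>
          mul_le_of_le_one_right (by positivity) (Psi_integral d)
  · rw [tsum_eq_single n]
    · rw [sub_self, Psi_zero, mul_one]
    · intro m hm
      rw [← latVec_sub, Psi_lat d _ (sub_ne_zero.mpr (Ne.symm hm)), mul_zero]

end
end

section
/- Let d ≥ 1. For all n, m ∈ ℤ^d, ∫₀^∞ ∫_{ℝ^d} |∇_x( P_s(x−m)/H_s(x) )| · |∇_x( P_s(x−n)/H_s(x) )| · H_s(x) dx ds ≤ 1, where ∇_x denotes the gradient in the x variable. -/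
open MeasureTheory Real Filter

noncomputable section

/-- one dimensional heat kernel -/
def pk (s x : ℝ) : ℝ := (2 * π * s) ^ (-(1 : ℝ) / 2) * Real.exp (-x ^ 2 / (2 * s))

def hk (s x : ℝ) : ℝ := ∑' k : ℤ, pk s (x - k)

def ek (s : ℝ) (n : ℤ) : ℝ := Real.exp (-(2 * π ^ 2 * s) * (n : ℝ) ^ 2)

def hA (s x : ℝ) : ℝ := ∑' n : ℤ, ek s n * Real.cos (2 * π * n * x)
def hB (s x : ℝ) : ℝ := ∑' n : ℤ, ek s n * (-(2 * π * n) * Real.sin (2 * π * n * x))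
def hC (s x : ℝ) : ℝ := ∑' n : ℤ, ek s n * (-(2 * π * n) ^ 2 * Real.cos (2 * π * n * x))

lemma ek_pos (s : ℝ) (n : ℤ) : 0 < ek s n := Real.exp_pos _

lemma ek_anti {a s : ℝ} (h : a ≤ s) (n : ℤ) : ek s n ≤ ek a n := by
  unfold ek
  apply Real.exp_le_exp.mpr
  have : 0 ≤ π ^ 2 * (n : ℝ) ^ 2 := by positivity
  nlinarith

lemma sum_ek {s : ℝ} (hs : 0 < s) (j : ℕ) : Summable fun n : ℤ => |2 * π * (n : ℝ)| ^ j * ek s n := by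
  have h := (summable_pow_mul_jacobiTheta₂_term_bound 0 (T := 2 * π * s) (by positivity) j).mul_left
    (|2 * π| ^ j)
  refine h.congr fun n => ?_
  unfold ek
  have e : -π * (2 * π * s * (n : ℝ) ^ 2 - 2 * 0 * ((|n| : ℤ) : ℝ)) = -(2 * π ^ 2 * s) * (n : ℝ) ^ 2 := by
    ring
  rw [e, abs_mul (2 * π) (n : ℝ), mul_pow, Int.cast_abs, mul_assoc (|2 * π| ^ j)]

def cB (a : ℝ) : ℝ := ∑' n : ℤ, |2 * π * (n : ℝ)| ^ 1 * ek a n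
def cC (a : ℝ) : ℝ := ∑' n : ℤ, |2 * π * (n : ℝ)| ^ 2 * ek a n

lemma termA {a s : ℝ} (h : a ≤ s) (n : ℤ) (x : ℝ) :
    ‖ek s n * Real.cos (2 * π * n * x)‖ ≤ |2 * π * (n : ℝ)| ^ 0 * ek a n := by
  rw [norm_mul, Real.norm_of_nonneg (ek_pos s n).le, pow_zero, one_mul]
  calc _ ≤ ek s n * 1 := by
        gcongr
        · exact (ek_pos s n).le
        · exact Real.abs_cos_le_one _
    _ ≤ _ := by rw [mul_one]; exact ek_anti h n

lemma termB {a s : ℝ} (h : a ≤ s) (n : ℤ) (x : ℝ) :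
    ‖ek s n * (-(2 * π * n) * Real.sin (2 * π * n * x))‖ ≤ |2 * π * (n : ℝ)| ^ 1 * ek a n := by
  rw [norm_mul, Real.norm_of_nonneg (ek_pos s n).le, pow_one, norm_mul, norm_neg, Real.norm_eq_abs, mul_comm]
  have h1 : ‖Real.sin (2 * π * n * x)‖ ≤ 1 := Real.abs_sin_le_one _
  have h2 := ek_anti h n
  have h3 := (ek_pos s n).le
  gcongr
  exact mul_le_of_le_one_right (abs_nonneg _) h1

lemma termC {a s : ℝ} (h : a ≤ s) (n : ℤ) (x : ℝ) :
    ‖ek s n * (-(2 * π * n) ^ 2 * Real.cos (2 * π * n * x))‖ ≤ |2 * π * (n : ℝ)| ^ 2 * ek a n := by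
  rw [norm_mul, Real.norm_of_nonneg (ek_pos s n).le, norm_mul, norm_neg, norm_pow, Real.norm_eq_abs, mul_comm]
  have h1 : ‖Real.cos (2 * π * n * x)‖ ≤ 1 := Real.abs_cos_le_one _
  have h2 := ek_anti h n
  have h3 := (ek_pos s n).le
  gcongr
  exact mul_le_of_le_one_right (by positivity) h1

lemma abs_hB_le {a s : ℝ} (ha : 0 < a) (h : a ≤ s) (x : ℝ) : |hB s x| ≤ cB a :=
  tsum_of_norm_bounded (sum_ek ha 1).hasSum (fun n => termB h n x)

lemma abs_hC_le {a s : ℝ} (ha : 0 < a) (h : a ≤ s) (x : ℝ) : |hC s x| ≤ cC a :=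
  tsum_of_norm_bounded (sum_ek ha 2).hasSum (fun n => termC h n x)

lemma cont_hC {s : ℝ} (hs : 0 < s) : Continuous (hC s) :=
  continuous_tsum (fun n => by fun_prop) (sum_ek hs 2) (fun n x => termC le_rfl n x)

lemma hasDeriv_hA {s : ℝ} (hs : 0 < s) (x : ℝ) : HasDerivAt (hA s) (hB s x) x := by
  refine hasDerivAt_tsum (y₀ := 0) (sum_ek hs 1) (fun n y => ?_) (fun n y => termB le_rfl n y)
    (Summable.of_norm_bounded (sum_ek hs 0) (fun n => termA le_rfl n 0)) x
  have := (((hasDerivAt_id y).const_mul (2 * π * (n : ℝ))).cos).const_mul (ek s n)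
  convert! this using 1
  simp only [id]; ring

lemma hasDeriv_hB {s : ℝ} (hs : 0 < s) (x : ℝ) : HasDerivAt (hB s) (hC s x) x := by
  refine hasDerivAt_tsum (y₀ := 0) (sum_ek hs 2) (fun n y => ?_) (fun n y => termC le_rfl n y)
    (Summable.of_norm_bounded (sum_ek hs 1) (fun n => termB le_rfl n 0)) x
  have := ((((hasDerivAt_id y).const_mul (2 * π * (n : ℝ))).sin).const_mul (-(2 * π * (n : ℝ)))).const_mul (ek s n)
  convert! this using 1
  simp only [id]; ring

lemma hasDeriv_hA_s {s : ℝ} (hs : 0 < s) (x : ℝ) :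
    HasDerivAt (fun t => hA t x) (hC s x / 2) s := by
  have ha : 0 < s / 2 := by linarith
  have key : HasDerivAt (fun t => hA t x)
      (∑' n : ℤ, (ek s n * (-(2 * π * n) ^ 2 * Real.cos (2 * π * n * x))) / 2) s := by
    refine hasDerivAt_tsum_of_isPreconnected (t := Set.Ioi (s / 2)) (y₀ := s)
      (g' := fun n t => (ek t n * (-(2 * π * n) ^ 2 * Real.cos (2 * π * n * x))) / 2)
      (sum_ek ha 2) isOpen_Ioi
      isPreconnected_Ioi (fun n y hy => ?_) (fun n y hy => ?_) (by simp; linarith)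
      (Summable.of_norm_bounded (sum_ek hs 0) (fun n => termA le_rfl n x)) (by simp; linarith)
    · have h1 : HasDerivAt (fun t : ℝ => -(2 * π ^ 2 * t) * (n : ℝ) ^ 2)
          (-(2 * π ^ 2 * 1) * (n : ℝ) ^ 2) y :=
        (((hasDerivAt_id y).const_mul (2 * π ^ 2)).neg).mul_const _
      have := (h1.exp).mul_const (Real.cos (2 * π * n * x))
      convert! this using 1
      unfold ek; ring
    · rw [norm_div]
      have := termC (le_of_lt hy) n x
      have h2 : ‖(2 : ℝ)‖ = 2 := by simp
      rw [h2]
      have h3 := norm_nonneg (ek y n * (-(2 * π * n) ^ 2 * Real.cos (2 * π * n * x)))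
      linarith
  rwa [tsum_div_const] at key

lemma pk_pos {s : ℝ} (hs : 0 < s) (x : ℝ) : 0 < pk s x := by unfold pk; positivity

lemma hk_eq_hA {s : ℝ} (hs : 0 < s) (x : ℝ) : hk s x = hA s x := by
  have hp : 0 < 2 * π * s := by positivity
  have h := Complex.tsum_exp_neg_quadratic (a := ((2 * π * s : ℝ) : ℂ)) (by simpa using hp)
    (Complex.I * x)
  have e1 : ∀ n : ℤ, Complex.exp (-π / ((2 * π * s : ℝ) : ℂ) * (n + Complex.I * (Complex.I * x)) ^ 2)
      = ((Real.exp (-(x - n) ^ 2 / (2 * s)) : ℝ) : ℂ) := by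
    intro n
    rw [Complex.ofReal_exp]
    congr 1
    have : (n + Complex.I * (Complex.I * x) : ℂ) = n - x := by
      rw [← mul_assoc, Complex.I_mul_I]; ring
    rw [this]
    have hs' : (s : ℂ) ≠ 0 := by exact_mod_cast hs.ne'
    have hpi : (π : ℂ) ≠ 0 := by exact_mod_cast Real.pi_ne_zero
    push_cast
    field_simp
    ring
  simp_rw [e1] at h
  rw [← Complex.ofReal_tsum] at h
  have e2 : (1 : ℂ) / ((2 * π * s : ℝ) : ℂ) ^ (1 / 2 : ℂ) = (((2 * π * s) ^ (-(1 : ℝ) / 2) : ℝ) : ℂ) := by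
    have : (1 / 2 : ℂ) = ((1 / 2 : ℝ) : ℂ) := by push_cast; rfl
    rw [this, ← Complex.ofReal_cpow hp.le, neg_div, Real.rpow_neg hp.le]
    push_cast
    rw [one_div]
  rw [e2, ← Complex.ofReal_mul] at h
  have hre := congrArg Complex.re h
  rw [Complex.ofReal_re] at hre
  have hl : hk s x = (2 * π * s) ^ (-(1 : ℝ) / 2) * ∑' n : ℤ, Real.exp (-(x - n) ^ 2 / (2 * s)) := by
    unfold hk pk; rw [tsum_mul_left]
  rw [hl, ← hre]
  have e3 : ∀ n : ℤ, Complex.exp (-π * ((2 * π * s : ℝ) : ℂ) * n ^ 2 + 2 * π * (Complex.I * x) * n)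
      = (ek s n : ℂ) * Complex.exp (((2 * π * n * x : ℝ) : ℂ) * Complex.I) := by
    intro n
    unfold ek
    rw [Complex.ofReal_exp, ← Complex.exp_add]
    congr 1
    push_cast; ring
  simp_rw [e3]
  have hsum : Summable fun n : ℤ => (ek s n : ℂ) * Complex.exp (((2 * π * n * x : ℝ) : ℂ) * Complex.I) := by
    refine Summable.of_norm_bounded (sum_ek hs 0) (fun n => ?_)
    rw [norm_mul, Complex.norm_exp_ofReal_mul_I, Complex.norm_real, Real.norm_of_nonneg (ek_pos s n).le]
    simp
  rw [Complex.re_tsum hsum]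
  unfold hA
  refine tsum_congr fun n => ?_
  rw [Complex.re_ofReal_mul, Complex.exp_ofReal_mul_I_re]

lemma sum_pk {s : ℝ} (hs : 0 < s) (x : ℝ) : Summable fun k : ℤ => pk s (x - k) := by
  unfold pk
  apply Summable.mul_left
  have h := (summable_pow_mul_jacobiTheta₂_term_bound (|x| / (2 * π * s)) (T := 1 / (2 * π * s)) (by positivity) 0)
  refine Summable.of_nonneg_of_le (fun _ => (Real.exp_pos _).le) (fun n => ?_) h
  rw [pow_zero, one_mul]
  apply Real.exp_le_exp.mpr
  have hx : x * n ≤ |x| * |(n : ℝ)| := by rw [← abs_mul]; exact le_abs_self _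
  have : -π * (1 / (2 * π * s) * (n : ℝ) ^ 2 - 2 * (|x| / (2 * π * s)) * ((|n| : ℤ) : ℝ))
     = (-(n : ℝ) ^ 2 + 2 * (|x| * |(n : ℝ)|)) / (2 * s) := by
    push_cast
    field_simp
    ring
  rw [this]
  gcongr
  nlinarith [sq_nonneg x]

lemma pk_le_hk {s : ℝ} (hs : 0 < s) (x : ℝ) (k : ℤ) : pk s (x - k) ≤ hk s x :=
  (sum_pk hs x).le_tsum k (fun _ _ => (pk_pos hs _).le)

lemma pk_le_hk0 {s : ℝ} (hs : 0 < s) (x : ℝ) : pk s x ≤ hk s x := by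
  simpa using pk_le_hk hs x 0

lemma hk_pos {s : ℝ} (hs : 0 < s) (x : ℝ) : 0 < hk s x :=
  (pk_pos hs x).trans_le (pk_le_hk0 hs x)

def lowB (a b : ℝ) : ℝ := (2 * π * b) ^ (-(1 : ℝ) / 2) * Real.exp (-1 / (2 * a))

lemma lowB_pos {a b : ℝ} (hb : 0 < b) : 0 < lowB a b := by unfold lowB; positivity

lemma lowB_le {a b s : ℝ} (ha : 0 < a) (has : a ≤ s) (hsb : s ≤ b) (x : ℝ) : lowB a b ≤ hk s x := by
  have hs : 0 < s := by linarith
  refine le_trans ?_ (pk_le_hk hs x (round x))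
  unfold lowB pk
  have h1 : (x - round x) ^ 2 ≤ 1 := by
    rw [← sq_abs]
    have := abs_sub_round x
    have := abs_nonneg (x - round x)
    nlinarith
  apply mul_le_mul
  · exact Real.rpow_le_rpow_of_nonpos (by positivity) (by gcongr) (by norm_num)
  · apply Real.exp_le_exp.mpr
    rw [neg_div, neg_div, neg_le_neg_iff]
    gcongr
  · positivity
  · positivity

lemma hasDeriv_pk {s : ℝ} (x : ℝ) : HasDerivAt (pk s) (-(x / s) * pk s x) x := by
  have h := (((((hasDerivAt_id x).pow 2).neg).div_const (2 * s)).exp).const_mul ((2 * π * s) ^ (-(1 : ℝ) / 2))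
  convert! h using 1
  unfold pk
  simp
  ring

lemma hasDeriv_pk_s {s : ℝ} (hs : 0 < s) (x : ℝ) :
    HasDerivAt (fun t => pk t x) ((x ^ 2 / s ^ 2 - 1 / s) / 2 * pk s x) s := by
  have hp : 0 < 2 * π * s := by positivity
  have h1 := ((hasDerivAt_id s).const_mul (2 * π)).rpow_const (p := -(1 : ℝ) / 2) (Or.inl hp.ne')
  have h2 : HasDerivAt (fun t : ℝ => -x ^ 2 / (2 * t)) (x ^ 2 / (2 * s ^ 2)) s := by
    have := (hasDerivAt_const s (-x ^ 2)).div ((hasDerivAt_id s).const_mul 2) (by simpa using hs.ne')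
    convert! this using 1
    simp; field_simp
  have h := h1.mul h2.exp
  convert! h using 1
  unfold pk
  simp only [id, mul_one]
  rw [Real.rpow_sub_one hp.ne']
  field_simp
  ring

lemma hk_fun {s : ℝ} (hs : 0 < s) : hk s = hA s := funext fun x => hk_eq_hA hs x

lemma hasDeriv_hk {s : ℝ} (hs : 0 < s) (x : ℝ) : HasDerivAt (hk s) (hB s x) x := by
  rw [hk_fun hs]; exact hasDeriv_hA hs x

lemma hasDeriv_hk_s {s : ℝ} (hs : 0 < s) (x : ℝ) :
    HasDerivAt (fun t => hk t x) (hC s x / 2) s := by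
  refine (hasDeriv_hA_s hs x).congr_of_eventuallyEq ?_
  filter_upwards [Ioi_mem_nhds hs] with t ht
  exact hk_eq_hA ht x

lemma cont_hk {s : ℝ} (hs : 0 < s) : Continuous (hk s) :=
  continuous_iff_continuousAt.mpr fun x => (hasDeriv_hk hs x).continuousAt

lemma cont_hB {s : ℝ} (hs : 0 < s) : Continuous (hB s) :=
  continuous_iff_continuousAt.mpr fun x => (hasDeriv_hB hs x).continuousAt

lemma cont_pk {s : ℝ} : Continuous (pk s) :=
  continuous_iff_continuousAt.mpr fun x => (hasDeriv_pk x).continuousAt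

def Ak (s x : ℝ) : ℝ := pk s x * (pk s x / hk s x)
def fk (s x : ℝ) : ℝ := pk s x / hk s x
def Ask (s x : ℝ) : ℝ := Ak s x * ((x ^ 2 / s ^ 2 - 1 / s) - hC s x / hk s x / 2)
def gk (s x : ℝ) : ℝ := Ak s x * (x / s + hB s x / hk s x) ^ 2
def Bk (s x : ℝ) : ℝ := Ak s x * (-(x / s) - hB s x / hk s x / 2)
def dfk (s x : ℝ) : ℝ := fk s x * (-(x / s + hB s x / hk s x))

lemma Ak_eq {s : ℝ} (hs : 0 < s) (x : ℝ) : Ak s x = fk s x ^ 2 * hk s x := by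
  have := (hk_pos hs x).ne'
  unfold Ak fk; field_simp

lemma gk_eq {s : ℝ} (hs : 0 < s) (x : ℝ) : gk s x = dfk s x ^ 2 * hk s x := by
  unfold gk dfk; rw [Ak_eq hs]; ring

lemma Ak_nonneg {s : ℝ} (hs : 0 < s) (x : ℝ) : 0 ≤ Ak s x := by
  have := hk_pos hs x
  have := pk_pos hs x
  unfold Ak; positivity

lemma gk_nonneg {s : ℝ} (hs : 0 < s) (x : ℝ) : 0 ≤ gk s x :=
  mul_nonneg (Ak_nonneg hs x) (sq_nonneg _)

lemma Ak_le {s : ℝ} (hs : 0 < s) (x : ℝ) : Ak s x ≤ pk s x := by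
  have h1 := hk_pos hs x
  exact mul_le_of_le_one_right (pk_pos hs x).le ((div_le_one h1).mpr (pk_le_hk0 hs x))

lemma cont_Ak {s : ℝ} (hs : 0 < s) : Continuous (Ak s) :=
  cont_pk.mul (cont_pk.div (cont_hk hs) fun x => (hk_pos hs x).ne')

lemma hasDeriv_fk {s : ℝ} (hs : 0 < s) (x : ℝ) : HasDerivAt (fk s) (dfk s x) x := by
  have h0 := (hk_pos hs x).ne'
  have := (hasDeriv_pk (s := s) x).div (hasDeriv_hk hs x) h0
  convert! this using 1
  unfold dfk fk; field_simp; ring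

lemma hasDeriv_Ak_s {s : ℝ} (hs : 0 < s) (x : ℝ) : HasDerivAt (fun t => Ak t x) (Ask s x) s := by
  have h0 := (hk_pos hs x).ne'
  have := (hasDeriv_pk_s hs x).mul ((hasDeriv_pk_s hs x).div (hasDeriv_hk_s hs x) h0)
  convert! this using 1
  unfold Ask Ak; simp only [Pi.div_apply]; field_simp; ring

lemma hasDeriv_Bk {s : ℝ} (hs : 0 < s) (x : ℝ) : HasDerivAt (Bk s) (Ask s x + gk s x) x := by
  have h0 := (hk_pos hs x).ne'
  have h1 := (hasDeriv_pk (s := s) x).mul ((hasDeriv_pk (s := s) x).div (hasDeriv_hk hs x) h0)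
  have h2 := (((hasDerivAt_id x).div_const s).neg).sub (((hasDeriv_hB hs x).div (hasDeriv_hk hs x) h0).div_const 2)
  have := h1.mul h2
  convert! this using 1
  unfold Ask gk Ak
  simp only [Pi.mul_apply, Pi.div_apply, Pi.neg_apply, Pi.sub_apply, id]
  field_simp
  ring

lemma int_maj {b : ℝ} (hb : 0 < b) (K : ℝ) :
    Integrable fun x : ℝ => K * (1 + x ^ 2) * Real.exp (-x ^ 2 / (2 * b)) := by
  have h1 := integrable_exp_neg_mul_sq (b := 1 / (2 * b)) (by positivity)
  have h2 := integrable_rpow_mul_exp_neg_mul_sq (b := 1 / (2 * b)) (by positivity) (s := 2) (by norm_num)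
  refine ((h1.add h2).const_mul K).congr (ae_of_all _ fun x => ?_)
  have e : -(1 / (2 * b)) * x ^ 2 = -x ^ 2 / (2 * b) := by ring
  simp only [Pi.add_apply, e]
  norm_num
  ring

def pre (a : ℝ) : ℝ := (2 * π * a) ^ (-(1 : ℝ) / 2)

lemma pk_le {a b s : ℝ} (ha : 0 < a) (has : a ≤ s) (hsb : s ≤ b) (x : ℝ) :
    pk s x ≤ pre a * Real.exp (-x ^ 2 / (2 * b)) := by
  have hs : 0 < s := by linarith
  have hb : 0 < b := by linarith
  unfold pk pre
  apply mul_le_mul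
  · exact Real.rpow_le_rpow_of_nonpos (by positivity) (by gcongr) (by norm_num)
  · apply Real.exp_le_exp.mpr
    rw [neg_div, neg_div, neg_le_neg_iff]
    gcongr
  · positivity
  · positivity

lemma Akw_le {a b s : ℝ} (ha : 0 < a) (has : a ≤ s) (hsb : s ≤ b) (x : ℝ) {w K : ℝ}
    (hw : |w| ≤ K * (1 + x ^ 2)) :
    ‖Ak s x * w‖ ≤ pre a * K * (1 + x ^ 2) * Real.exp (-x ^ 2 / (2 * b)) := by
  have hs : 0 < s := by linarith
  rw [norm_mul, Real.norm_of_nonneg (Ak_nonneg hs x), Real.norm_eq_abs]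
  calc _ ≤ (pre a * Real.exp (-x ^ 2 / (2 * b))) * (K * (1 + x ^ 2)) := by
        apply mul_le_mul ((Ak_le hs x).trans (pk_le ha has hsb x)) hw (abs_nonneg _)
        unfold pre; positivity
    _ = _ := by ring

lemma int_Akw {s : ℝ} (hs : 0 < s) {w : ℝ → ℝ} (hc : Continuous w) {K : ℝ}
    (hw : ∀ x, |w x| ≤ K * (1 + x ^ 2)) : Integrable fun x => Ak s x * w x :=
  (int_maj hs (pre s * K)).mono' ((cont_Ak hs).mul hc).aestronglyMeasurable
    (ae_of_all _ fun x => Akw_le hs le_rfl le_rfl x (hw x))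

lemma rB_le {a b s : ℝ} (ha : 0 < a) (has : a ≤ s) (hsb : s ≤ b) (x : ℝ) :
    |hB s x / hk s x| ≤ cB a / lowB a b := by
  have hs : 0 < s := by linarith
  rw [abs_div, abs_of_pos (hk_pos hs x)]
  exact div_le_div₀ ((abs_nonneg _).trans (abs_hB_le ha has x)) (abs_hB_le ha has x)
    (lowB_pos (by linarith)) (lowB_le ha has hsb x)

lemma rC_le {a b s : ℝ} (ha : 0 < a) (has : a ≤ s) (hsb : s ≤ b) (x : ℝ) :
    |hC s x / hk s x| ≤ cC a / lowB a b := by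
  have hs : 0 < s := by linarith
  rw [abs_div, abs_of_pos (hk_pos hs x)]
  exact div_le_div₀ ((abs_nonneg _).trans (abs_hC_le ha has x)) (abs_hC_le ha has x)
    (lowB_pos (by linarith)) (lowB_le ha has hsb x)

lemma wA_le {a b s : ℝ} (ha : 0 < a) (has : a ≤ s) (hsb : s ≤ b) (x : ℝ) :
    |(x ^ 2 / s ^ 2 - 1 / s) - hC s x / hk s x / 2| ≤
      (1 / a ^ 2 + 1 / a + cC a / lowB a b) * (1 + x ^ 2) := by
  have hs : 0 < s := by linarith
  have h1 := rC_le ha has hsb x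
  set c := cC a / lowB a b
  have h2 : x ^ 2 / s ^ 2 ≤ 1 / a ^ 2 * x ^ 2 := by
    rw [div_mul_eq_mul_div, one_mul]; gcongr
  have h3 : 1 / s ≤ 1 / a := by gcongr
  have h4 : 0 ≤ x ^ 2 / s ^ 2 := by positivity
  have h5 : 0 < 1 / s := by positivity
  have h6 : 0 < 1 / a ^ 2 := by positivity
  rw [abs_le] at h1
  have hc : 0 ≤ c := by linarith
  have h7 := sq_nonneg x
  have h8 : 0 ≤ c * x ^ 2 := by positivity
  have h9 : 0 ≤ 1 / a * x ^ 2 := by positivity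
  rw [abs_le]
  constructor <;> nlinarith

lemma wg_le {s : ℝ} (hs : 0 < s) (x : ℝ) :
    |(x / s + hB s x / hk s x) ^ 2| ≤ (2 / s ^ 2 + 2 * (cB s / lowB s s) ^ 2) * (1 + x ^ 2) := by
  have h1 := rB_le hs le_rfl le_rfl x
  set c := cB s / lowB s s
  set r := hB s x / hk s x
  have h2 : r ^ 2 ≤ c ^ 2 := by rw [← sq_abs]; gcongr
  rw [abs_of_nonneg (sq_nonneg _)]
  have h3 : (x / s + r) ^ 2 ≤ 2 * (x / s) ^ 2 + 2 * r ^ 2 := by nlinarith [sq_nonneg (x / s - r)]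
  have h4 : (x / s) ^ 2 = 1 / s ^ 2 * x ^ 2 := by rw [div_pow]; ring
  have h5 : 0 < 1 / s ^ 2 := by positivity
  have h6 : 2 / s ^ 2 = 2 * (1 / s ^ 2) := by ring
  rw [h6]
  nlinarith [mul_nonneg (sq_nonneg c) (sq_nonneg x)]

lemma wB_le {s : ℝ} (hs : 0 < s) (x : ℝ) :
    |(-(x / s) - hB s x / hk s x / 2)| ≤ (1 / s + cB s / lowB s s) * (1 + x ^ 2) := by
  have h1 := rB_le hs le_rfl le_rfl x
  set c := cB s / lowB s s
  set r := hB s x / hk s x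
  have h3 : x / s = 1 / s * x := by ring
  have h5 : 0 < 1 / s := by positivity
  rw [h3]
  set t := 1 / s
  rw [abs_le] at h1
  have hc : 0 ≤ c := by linarith
  have h8 : 0 ≤ c * x ^ 2 := by positivity
  rw [abs_le]
  constructor <;> nlinarith [mul_nonneg h5.le (sq_nonneg (x - 1)), mul_nonneg h5.le (sq_nonneg (x + 1)), mul_nonneg h5.le (sq_nonneg x)]

lemma cont_r {s : ℝ} (hs : 0 < s) : Continuous fun x => hB s x / hk s x :=
  (cont_hB hs).div (cont_hk hs) fun x => (hk_pos hs x).ne'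

lemma cont_wA {s : ℝ} (hs : 0 < s) :
    Continuous fun x => (x ^ 2 / s ^ 2 - 1 / s) - hC s x / hk s x / 2 := by
  have : Continuous fun x => hC s x / hk s x :=
    (cont_hC hs).div (cont_hk hs) fun x => (hk_pos hs x).ne'
  fun_prop

lemma int_gk {s : ℝ} (hs : 0 < s) : Integrable (gk s) :=
  int_Akw hs (by have := cont_r hs; fun_prop) (wg_le hs)

lemma int_Bk {s : ℝ} (hs : 0 < s) : Integrable (Bk s) :=
  int_Akw hs (by have := cont_r hs; fun_prop) (wB_le hs)

lemma int_Ask {s : ℝ} (hs : 0 < s) : Integrable (Ask s) :=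
  int_Akw hs (cont_wA hs) (wA_le hs le_rfl le_rfl)

lemma int_Ak {s : ℝ} (hs : 0 < s) : Integrable (Ak s) := by
  have := int_Akw hs (w := fun _ => 1) continuous_const (K := 1) (fun x => by
    rw [abs_one]; nlinarith [sq_nonneg x])
  simpa using this

def Fk (s : ℝ) : ℝ := ∫ x, Ak s x
def Gk (s : ℝ) : ℝ := ∫ x, gk s x

lemma hasDeriv_Fk {s : ℝ} (hs : 0 < s) : HasDerivAt Fk (-Gk s) s := by
  have ha : 0 < s / 2 := by linarith
  have h := hasDerivAt_integral_of_dominated_loc_of_deriv_le (μ := volume) (F := Ak) (F' := Ask) (x₀ := s)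
    (s := Set.Ioo (s / 2) (2 * s))
    (bound := fun x => pre (s / 2) * (1 / (s / 2) ^ 2 + 1 / (s / 2) + cC (s / 2) / lowB (s / 2) (2 * s)) *
      (1 + x ^ 2) * Real.exp (-x ^ 2 / (2 * (2 * s))))
    (Ioo_mem_nhds (by linarith) (by linarith))
    (by filter_upwards [Ioi_mem_nhds hs] with t ht using (cont_Ak ht).aestronglyMeasurable)
    (int_Ak hs) (int_Ask hs).aestronglyMeasurable
    (ae_of_all _ fun x t ht => Akw_le ha ht.1.le ht.2.le x (wA_le ha ht.1.le ht.2.le x))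
    (int_maj (by linarith) _)
    (ae_of_all _ fun x t ht => hasDeriv_Ak_s (by linarith [ht.1]) x)
  have h0 := integral_eq_zero_of_hasDerivAt_of_integrable (hasDeriv_Bk hs)
    ((int_Ask hs).add (int_gk hs)) (int_Bk hs)
  rw [integral_add (int_Ask hs) (int_gk hs)] at h0
  have : -Gk s = ∫ x, Ask s x := by unfold Gk; linarith
  rw [this]
  exact h.2

lemma Fk_nonneg {s : ℝ} (hs : 0 < s) : 0 ≤ Fk s := integral_nonneg (Ak_nonneg hs)
lemma Gk_nonneg {s : ℝ} (hs : 0 < s) : 0 ≤ Gk s := integral_nonneg (gk_nonneg hs)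

lemma int_pk {s : ℝ} (hs : 0 < s) : Integrable (pk s) := by
  have h1 := (integrable_exp_neg_mul_sq (b := 1 / (2 * s)) (by positivity)).const_mul (pre s)
  refine h1.congr (ae_of_all _ fun x => ?_)
  have e : -(1 / (2 * s)) * x ^ 2 = -x ^ 2 / (2 * s) := by ring
  simp only [e]; rfl

lemma integral_pk {s : ℝ} (hs : 0 < s) : ∫ x, pk s x = 1 := by
  have h := integral_gaussian (1 / (2 * s))
  have e : ∀ x : ℝ, -(1 / (2 * s)) * x ^ 2 = -x ^ 2 / (2 * s) := fun x => by ring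
  simp_rw [e] at h
  unfold pk
  rw [integral_const_mul, h]
  have hp : 0 < 2 * π * s := by positivity
  have : π / (1 / (2 * s)) = 2 * π * s := by field_simp
  rw [this, Real.sqrt_eq_rpow, ← Real.rpow_add hp]
  norm_num

lemma Fk_le {s : ℝ} (hs : 0 < s) : Fk s ≤ 1 := by
  rw [← integral_pk hs]
  exact integral_mono (int_Ak hs) (int_pk hs) (Ak_le hs)

lemma tsum_pi_aux (d : ℕ) (F : Fin d → ℤ → ℝ) (h0 : ∀ i k, 0 ≤ F i k) (hs : ∀ i, Summable (F i)) :
    HasSum (fun n : Fin d → ℤ => ∏ i, F i (n i)) (∏ i, ∑' k, F i k) := by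
  induction d with
  | zero => 
    simp only [Finset.univ_eq_empty, Finset.prod_empty]
    exact hasSum_unique _
  | succ d ih =>
    have h1 := ih (fun i => F i.succ) (fun i k => h0 _ k) (fun i => hs _)
    have n1 : (0 : ℤ → ℝ) ≤ F 0 := by
      intro k
      simpa using h0 0 k
    have n2 : (0 : (Fin d → ℤ) → ℝ) ≤ fun n => ∏ i, F (Fin.succ i) (n i) := by
      intro n
      exact Finset.prod_nonneg fun i _ => h0 _ _
    have h3 := Summable.mul_of_nonneg (hs 0) h1.summable n1 n2
    have h2 := HasSum.mul (hs 0).hasSum h1 h3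
    rw [Fin.prod_univ_succ]
    rw [← (Fin.consEquiv (fun _ : Fin (d + 1) => ℤ)).hasSum_iff]
    convert! h2 using 1
    funext p
    simp [Fin.prod_univ_succ, Fin.consEquiv]

lemma heatK_eq {d : ℕ} {s : ℝ} (hs : 0 < s) (x : EuclideanSpace ℝ (Fin d)) :
    heatK d s x = ∏ i, pk s (x i) := by
  unfold heatK pk
  rw [Finset.prod_mul_distrib, Finset.prod_const, ← Real.exp_sum, Finset.card_univ, Fintype.card_fin,
    ← Real.rpow_natCast _ d, ← Real.rpow_mul (by positivity), EuclideanSpace.norm_sq_eq,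
    ← Finset.sum_div, Finset.sum_neg_distrib]
  simp only [Real.norm_eq_abs, sq_abs]
  congr 2
  ring

lemma pHeatK_eq {d : ℕ} {s : ℝ} (hs : 0 < s) (x : EuclideanSpace ℝ (Fin d)) :
    pHeatK d s x = ∏ i, hk s (x i) := by
  unfold pHeatK hk
  simp_rw [heatK_eq hs]
  exact (tsum_pi_aux d (fun i k => pk s (x i - k)) (fun i k => (pk_pos hs _).le)
    (fun i => sum_pk hs _)).tsum_eq

lemma pHeatK_per {d : ℕ} {s : ℝ} (n : ZLat d) (x : EuclideanSpace ℝ (Fin d)) :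
    pHeatK d s (x - latVec n) = pHeatK d s x := by
  unfold pHeatK
  rw [← (Equiv.addLeft n).tsum_eq (fun k : ZLat d => heatK d s (x - latVec k))]
  refine tsum_congr fun k => ?_
  congr 1
  have : latVec (n + k) = latVec n + latVec k := by
    ext i; simp [latVec]
  simp only [Equiv.coe_addLeft, this]
  abel

def phi (d : ℕ) (s : ℝ) (y : EuclideanSpace ℝ (Fin d)) : ℝ := heatK d s y / pHeatK d s y

lemma phi_eq {d : ℕ} {s : ℝ} (hs : 0 < s) : phi d s = fun y => ∏ i, fk s (y i) := by
  funext y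
  unfold phi fk
  rw [heatK_eq hs, pHeatK_eq hs, Finset.prod_div_distrib]

lemma fderiv_shift {d : ℕ} {s : ℝ} (n : ZLat d) (x : EuclideanSpace ℝ (Fin d)) :
    fderiv ℝ (fun y => heatK d s (y - latVec n) / pHeatK d s y) x = fderiv ℝ (phi d s) (x - latVec n) := by
  rw [← fderiv_comp_sub]
  congr 1
  funext y
  unfold phi
  rw [pHeatK_per]

lemma hasF_phi {d : ℕ} {s : ℝ} (hs : 0 < s) (x : EuclideanSpace ℝ (Fin d)) :
    HasFDerivAt (phi d s) (∑ i, (∏ j ∈ Finset.univ.erase i, fk s (x j)) •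
      (dfk s (x i) • (EuclideanSpace.proj i : EuclideanSpace ℝ (Fin d) →L[ℝ] ℝ))) x := by
  rw [phi_eq hs]
  refine HasFDerivAt.finsetProd (u := Finset.univ) (g := fun i (y : EuclideanSpace ℝ (Fin d)) => fk s (y i)) fun i _ => ?_
  exact (hasDeriv_fk hs (x i)).comp_hasFDerivAt x
    (EuclideanSpace.proj i : EuclideanSpace ℝ (Fin d) →L[ℝ] ℝ).hasFDerivAt

lemma norm_sum_proj {d : ℕ} (c : Fin d → ℝ) :
    ‖∑ i, c i • (EuclideanSpace.proj i : EuclideanSpace ℝ (Fin d) →L[ℝ] ℝ)‖ ^ 2 ≤ ∑ i, c i ^ 2 := by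
  have : ‖∑ i, c i • (EuclideanSpace.proj i : EuclideanSpace ℝ (Fin d) →L[ℝ] ℝ)‖ ≤ √(∑ i, c i ^ 2) := by
    refine ContinuousLinearMap.opNorm_le_bound _ (Real.sqrt_nonneg _) fun x => ?_
    rw [EuclideanSpace.norm_eq, ← Real.sqrt_mul (Finset.sum_nonneg fun i _ => sq_nonneg _)]
    apply Real.le_sqrt_of_sq_le
    have := Finset.sum_mul_sq_le_sq_mul_sq Finset.univ c (fun i => x i)
    simpa [_root_.sum_apply] using this
  calc _ ≤ √(∑ i, c i ^ 2) ^ 2 := by gcongr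
    _ = _ := Real.sq_sqrt (Finset.sum_nonneg fun i _ => sq_nonneg _)

/-- upper bound for the energy density -/
def Psi (d : ℕ) (s : ℝ) (x : EuclideanSpace ℝ (Fin d)) : ℝ :=
  ∑ i, ∏ j, (if j = i then gk s (x j) else Ak s (x j))

lemma energy_le {d : ℕ} {s : ℝ} (hs : 0 < s) (x : EuclideanSpace ℝ (Fin d)) :
    ‖fderiv ℝ (phi d s) x‖ ^ 2 * pHeatK d s x ≤ Psi d s x := by
  rw [(hasF_phi hs x).fderiv, pHeatK_eq hs]
  simp_rw [smul_smul]
  refine (mul_le_mul_of_nonneg_right (norm_sum_proj _)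
    (Finset.prod_nonneg fun i _ => (hk_pos hs _).le)).trans (le_of_eq ?_)
  unfold Psi
  rw [Finset.sum_mul]
  refine Finset.sum_congr rfl fun i _ => ?_
  rw [← Finset.mul_prod_erase Finset.univ (fun j => hk s (x j)) (Finset.mem_univ i),
    ← Finset.mul_prod_erase Finset.univ _ (Finset.mem_univ i), if_pos rfl]
  have : ∏ j ∈ Finset.univ.erase i, (if j = i then gk s (x j) else Ak s (x j)) =
      (∏ j ∈ Finset.univ.erase i, fk s (x j)) ^ 2 * ∏ j ∈ Finset.univ.erase i, hk s (x j) := by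
    rw [← Finset.prod_pow, ← Finset.prod_mul_distrib]
    refine Finset.prod_congr rfl fun j hj => ?_
    rw [if_neg (Finset.ne_of_mem_erase hj), Ak_eq hs]
  rw [this, gk_eq hs]
  ring

lemma int_Psi_term {d : ℕ} {s : ℝ} (hs : 0 < s) (i : Fin d) :
    Integrable (fun x : EuclideanSpace ℝ (Fin d) => ∏ j, (if j = i then gk s (x j) else Ak s (x j))) := by
  have h := Integrable.fintype_prod (μ := fun _ : Fin d => (volume : Measure ℝ))
    (f := fun j (t : ℝ) => if j = i then gk s t else Ak s t)
    (fun j => by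
      by_cases h : j = i
      · simpa [h] using int_gk hs
      · simpa [h] using int_Ak hs)
  exact (PiLp.volume_preserving_ofLp (Fin d)).integrable_comp_of_integrable h

lemma integral_Psi_term {d : ℕ} {s : ℝ} (i : Fin d) :
    ∫ x : EuclideanSpace ℝ (Fin d), ∏ j, (if j = i then gk s (x j) else Ak s (x j)) =
      Gk s * Fk s ^ (d - 1) := by
  have h := (EuclideanSpace.volume_preserving_symm_measurableEquiv_toLp (Fin d)).integral_comp' (fun x : Fin d → ℝ => ∏ j, (if j = i then gk s (x j) else Ak s (x j)))
  refine h.trans ?_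
  rw [integral_fintype_prod_volume_eq_prod (fun j (t : ℝ) => if j = i then gk s t else Ak s t),
    ← Finset.mul_prod_erase Finset.univ _ (Finset.mem_univ i)]
  simp only [if_true]
  have : ∏ j ∈ Finset.univ.erase i, (∫ t, if j = i then gk s t else Ak s t) =
      ∏ j ∈ Finset.univ.erase i, Fk s := by
    refine Finset.prod_congr rfl fun j hj => ?_
    simp only [if_neg (Finset.ne_of_mem_erase hj)]
    rfl
  rw [this, Finset.prod_const, Finset.card_erase_of_mem (Finset.mem_univ i), Finset.card_univ,
    Fintype.card_fin]
  rfl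

lemma int_Psi {d : ℕ} {s : ℝ} (hs : 0 < s) : Integrable (Psi d s) :=
  integrable_finsetSum _ fun i _ => int_Psi_term hs i

lemma integral_Psi {d : ℕ} {s : ℝ} (hs : 0 < s) : ∫ x, Psi d s x = d * Fk s ^ (d - 1) * Gk s := by
  unfold Psi
  rw [integral_finsetSum _ fun i _ => int_Psi_term hs i]
  simp_rw [integral_Psi_term]
  simp
  ring

lemma inner_le {d : ℕ} {s : ℝ} (hs : 0 < s) (n m : ZLat d) :
    (∫ x : EuclideanSpace ℝ (Fin d),
      ‖fderiv ℝ (fun y => heatK d s (y - latVec m) / pHeatK d s y) x‖ *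
        ‖fderiv ℝ (fun y => heatK d s (y - latVec n) / pHeatK d s y) x‖ *
        pHeatK d s x) ≤ d * Fk s ^ (d - 1) * Gk s := by
  have hH : ∀ x, 0 ≤ pHeatK d s x := fun x => by
    rw [pHeatK_eq hs]; exact Finset.prod_nonneg fun i _ => (hk_pos hs _).le
  have e : ∫ x, (1 / 2 * Psi d s (x - latVec m) + 1 / 2 * Psi d s (x - latVec n)) =
      d * Fk s ^ (d - 1) * Gk s := by
    rw [integral_add (((int_Psi hs).comp_sub_right _).const_mul _)
      (((int_Psi hs).comp_sub_right _).const_mul _), integral_const_mul, integral_const_mul,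
      integral_sub_right_eq_self (Psi d s), integral_sub_right_eq_self (Psi d s), integral_Psi hs]
    ring
  rw [← e]
  refine integral_mono_of_nonneg (ae_of_all _ fun x => ?_)
    ((((int_Psi hs).comp_sub_right _).const_mul _).add
      (((int_Psi hs).comp_sub_right _).const_mul _)) (ae_of_all _ fun x => ?_)
  · exact mul_nonneg (by positivity) (hH x)
  · have h1 := energy_le hs (x - latVec m)
    have h2 := energy_le hs (x - latVec n)
    rw [pHeatK_per] at h1 h2
    simp only [fderiv_shift]
    set A := ‖fderiv ℝ (phi d s) (x - latVec m)‖
    set B := ‖fderiv ℝ (phi d s) (x - latVec n)‖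
    nlinarith [mul_nonneg (sq_nonneg (A - B)) (hH x)]

lemma anti_lim {Φ φ : ℝ → ℝ} (hd : ∀ s, 0 < s → HasDerivAt Φ (-φ s) s) (h0 : ∀ s, 0 < s → 0 ≤ φ s)
    (hΦ0 : ∀ s, 0 < s → 0 ≤ Φ s) (hΦ1 : ∀ s, 0 < s → Φ s ≤ 1) :
    IntegrableOn φ (Set.Ioi 0) ∧ ∫ s in Set.Ioi (0 : ℝ), φ s ≤ 1 := by
  have hanti : AntitoneOn Φ (Set.Ioi 0) := by
    refine antitoneOn_of_deriv_nonpos (convex_Ioi 0)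
      (fun s hs => (hd s hs).continuousAt.continuousWithinAt)
      (fun s hs => ?_) (fun s hs => ?_)
    · rw [interior_Ioi] at hs
      exact (hd s hs).differentiableAt.differentiableWithinAt
    · rw [interior_Ioi] at hs
      rw [(hd s hs).deriv]
      linarith [h0 s hs]
  -- limit at infinity
  obtain ⟨l, hl⟩ : ∃ l, Tendsto Φ atTop (nhds l) := by
    have hA : Antitone fun t : ℝ => Φ (max t 1) := fun a b hab =>
      hanti (by simp) (by simp) (max_le_max_right 1 hab)
    have hb : BddBelow (Set.range fun t : ℝ => Φ (max t 1)) :=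
      ⟨0, by rintro _ ⟨t, rfl⟩; exact hΦ0 _ (by simp)⟩
    refine ⟨_, (tendsto_atTop_ciInf hA hb).congr' ?_⟩
    filter_upwards [eventually_ge_atTop 1] with t ht
    rw [max_eq_left ht]
  have hl0 : 0 ≤ l := ge_of_tendsto hl (by filter_upwards [eventually_gt_atTop 0] with t ht using hΦ0 t ht)
  obtain ⟨u, hu⟩ : ∃ u, Tendsto Φ (nhdsWithin 0 (Set.Ioi 0)) (nhds u) := by
    have hA : Monotone fun t : ℝ => Φ ((max t 1)⁻¹) := fun a b hab =>
      hanti (by simp) (by simp) (by gcongr)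
    have hb : BddAbove (Set.range fun t : ℝ => Φ ((max t 1)⁻¹)) :=
      ⟨1, by rintro _ ⟨t, rfl⟩; exact hΦ1 _ (by simp)⟩
    refine ⟨_, ((tendsto_atTop_ciSup hA hb).comp tendsto_inv_nhdsGT_zero).congr' ?_⟩
    have : Set.Ioo (0 : ℝ) 1 ∈ nhdsWithin (0 : ℝ) (Set.Ioi 0) := Ioo_mem_nhdsGT one_pos
    filter_upwards [this] with t ht
    have : 1 ≤ t⁻¹ := (one_le_inv₀ ht.1).mpr ht.2.le
    simp [max_eq_left this]
  have hu1 : u ≤ 1 := le_of_tendsto hu (by filter_upwards [self_mem_nhdsWithin] with t ht using hΦ1 t ht)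
  set Ψ := Function.update Φ 0 u with hΨ
  have hev : ∀ s, 0 < s → Ψ =ᶠ[nhds s] Φ := fun s hs => by
    filter_upwards [Ioi_mem_nhds hs] with t ht
    exact Function.update_of_ne (ne_of_gt ht) _ _
  have hc : ContinuousWithinAt Ψ (Set.Ici 0) 0 := by
    rw [hΨ, continuousWithinAt_update_same]
    simpa using hu
  have hD : ∀ s ∈ Set.Ioi (0 : ℝ), HasDerivAt Ψ (-φ s) s := fun s hs =>
    (hd s hs).congr_of_eventuallyEq (hev s hs)
  have hneg : ∀ s ∈ Set.Ioi (0 : ℝ), -φ s ≤ 0 := fun s hs => by linarith [h0 s hs]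
  have hT : Tendsto Ψ atTop (nhds l) := hl.congr' (by
    filter_upwards [eventually_gt_atTop 0] with t ht
    exact (Function.update_of_ne (ne_of_gt ht) _ _).symm)
  have i1 := integrableOn_Ioi_deriv_of_nonpos hc hD hneg hT
  have i2 := integral_Ioi_of_hasDerivAt_of_nonpos hc hD hneg hT
  refine ⟨by simpa using i1.neg, ?_⟩
  rw [integral_neg] at i2
  have : Ψ 0 = u := by simp [hΨ]
  rw [this] at i2
  linarith

theorem stmt6 (d : ℕ) (hd : 1 ≤ d) (n m : ZLat d) :
    (∫ s in Set.Ioi (0 : ℝ), ∫ x : EuclideanSpace ℝ (Fin d),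
      ‖fderiv ℝ (fun y => heatK d s (y - latVec m) / pHeatK d s y) x‖ *
        ‖fderiv ℝ (fun y => heatK d s (y - latVec n) / pHeatK d s y) x‖ *
        pHeatK d s x) ≤ 1 := by
  have key := anti_lim (Φ := fun s => Fk s ^ d) (φ := fun s => d * Fk s ^ (d - 1) * Gk s)
    (fun s hs => by
      have := (hasDeriv_Fk hs).pow d
      convert! this using 1
      ring)
    (fun s hs => by
      have := Fk_nonneg hs
      have := Gk_nonneg hs
      positivity)
    (fun s hs => pow_nonneg (Fk_nonneg hs) _)
    (fun s hs => pow_le_one₀ (Fk_nonneg hs) (Fk_le hs))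
  refine le_trans (integral_mono_of_nonneg ?_ key.1 ?_) key.2
  · filter_upwards [ae_restrict_mem measurableSet_Ioi] with s hs
    refine integral_nonneg fun x => mul_nonneg (by positivity) ?_
    rw [pHeatK_eq hs]
    exact Finset.prod_nonneg fun i _ => (hk_pos hs _).le
  · filter_upwards [ae_restrict_mem measurableSet_Ioi] with s hs
    exact inner_le hs n m

end
end

section
/- Let d ≥ 1 and let A : ℝ^d × (0,∞) → M_d(ℝ) be a measurable matrix-valued function with sup_{(x,s)} ‖A(x,s)‖ < ∞ (operator norm). Then for all m, n ∈ ℤ^d the limit lim_{T→∞} (2πT)^{d/2} ∫₀^T ∫_{ℝ^d} ∇_x( P_s(x−m)/H_s(x) ) · A(x,s) ∇_x( P_s(x−n)/H_s(x) ) · P_{T−s}(x) H_s(x) dx ds exists and equals ∫₀^∞ ∫_{ℝ^d} H_s(x) ∇_x( P_s(x−m)/H_s(x) ) · A(x,s) ∇_x( P_s(x−n)/H_s(x) ) dx ds. -/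
open MeasureTheory Real Filter

noncomputable section

abbrev EE (d : ℕ) := EuclideanSpace ℝ (Fin d)

def cubeZ {d : ℕ} (k : ZLat d) : Set (EE d) := {y | ∀ i, ⌊y i⌋ = k i}

lemma cubeZ_meas {d : ℕ} (k : ZLat d) : MeasurableSet (cubeZ k) := by
  have : cubeZ k = ⋂ i, {y : EE d | ⌊y i⌋ = k i} := by ext; simp [cubeZ]
  rw [this]
  refine MeasurableSet.iInter fun i => ?_
  have h : Measurable fun y : EE d => ⌊y i⌋ := Int.measurable_floor.comp (by fun_prop)
  exact h (measurableSet_singleton (k i))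

lemma cubeZ_vol {d : ℕ} (k : ZLat d) : volume (cubeZ k) = 1 := by
  have h := (EuclideanSpace.volume_preserving_symm_measurableEquiv_toLp (Fin d)).measure_preimage_equiv
    (Set.pi Set.univ fun i => Set.Ico (k i : ℝ) (k i + 1))
  rw [Real.volume_pi_Ico] at h
  have e : (MeasurableEquiv.toLp 2 (Fin d → ℝ)).symm ⁻¹' (Set.pi Set.univ fun i => Set.Ico (k i : ℝ) (k i + 1)) = cubeZ k := by
    ext y
    simp [cubeZ, Int.floor_eq_iff]
  rw [e] at h
  rw [h]; simp

lemma cubeZ_disj {d : ℕ} : Pairwise (Function.onFun Disjoint (cubeZ (d := d))) := by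
  intro k l hkl
  rw [Function.onFun, Set.disjoint_left]
  intro y h1 h2
  exact hkl (funext fun i => (h1 i).symm.trans (h2 i))

lemma cubeZ_union {d : ℕ} : (⋃ k, cubeZ (d := d) k) = Set.univ := by
  ext y; simp only [Set.mem_iUnion, Set.mem_univ, iff_true]
  exact ⟨fun i => ⌊y i⌋, fun i => rfl⟩

lemma tile {d : ℕ} (f : EE d → ℝ) (hf : Integrable f) :
    HasSum (fun k => ∫ y in cubeZ k, f y) (∫ y, f y) := by
  have := hasSum_integral_iUnion (μ := volume) (f := f) cubeZ_meas cubeZ_disj hf.integrableOn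
  rwa [cubeZ_union, setIntegral_univ] at this

lemma cubeZ_dist {d : ℕ} (k : ZLat d) (y : EE d) (hy : y ∈ cubeZ k) : ‖y - latVec k‖ ^ 2 ≤ d := by
  rw [EuclideanSpace.norm_sq_eq]
  calc ∑ i, ‖(y - latVec k) i‖ ^ 2 ≤ ∑ i : Fin d, (1:ℝ) := by
        refine Finset.sum_le_sum fun i _ => ?_
        have := hy i
        rw [Int.floor_eq_iff] at this
        simp only [latVec, PiLp.sub_apply, Real.norm_eq_abs, sq_abs]
        nlinarith
    _ = d := by simp

lemma gint {d : ℕ} (a : ℝ) (ha : 0 < a) (x : EE d) :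
    Integrable (fun y : EE d => Real.exp (-a * ‖x - y‖ ^ 2)) ∧
    ∫ y : EE d, Real.exp (-a * ‖x - y‖ ^ 2) = (π / a) ^ ((d : ℝ) / 2) := by
  have h := GaussianFourier.integral_rexp_neg_mul_sq_norm (V := EE d) ha
  have h0 : Integrable (fun y : EE d => Real.exp (-a * ‖y‖ ^ 2)) := by
    by_contra hn
    rw [integral_undef hn] at h
    have : 0 < (π / a) ^ ((Module.finrank ℝ (EE d) : ℝ) / 2) := by positivity
    linarith
  refine ⟨h0.comp_sub_left x, ?_⟩
  rw [integral_sub_left_eq_self (fun y : EE d => Real.exp (-a * ‖y‖ ^ 2)) volume x, h]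
  simp

lemma norm_sq_le2 {d : ℕ} (u v : EE d) : ‖u + v‖ ^ 2 ≤ 2 * ‖u‖ ^ 2 + 2 * ‖v‖ ^ 2 := by
  have := norm_add_le u v
  nlinarith [norm_nonneg (u + v), norm_nonneg u, norm_nonneg v, sq_nonneg (‖u‖ - ‖v‖)]

lemma cubeZ_const {d : ℕ} (k : ZLat d) (c : ℝ) : ∫ _ in cubeZ k, c = c := by
  simp [Measure.real, cubeZ_vol]

lemma gsum {d : ℕ} (a : ℝ) (ha : 0 < a) (x : EE d) :
    Summable (fun k : ZLat d => Real.exp (-a * ‖x - latVec k‖ ^ 2)) ∧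
    ∑' k : ZLat d, Real.exp (-a * ‖x - latVec k‖ ^ 2) ≤
      Real.exp (a * d) * (π / (a / 2)) ^ ((d : ℝ) / 2) ∧
    Real.exp (-(2 * a * d)) * (π / (2 * a)) ^ ((d : ℝ) / 2) ≤
      ∑' k : ZLat d, Real.exp (-a * ‖x - latVec k‖ ^ 2) := by
  obtain ⟨i1, v1⟩ := gint (a / 2) (by positivity) x
  obtain ⟨i2, v2⟩ := gint (2 * a) (by positivity) x
  have t1 := (tile _ i1).mul_left (Real.exp (a * d))
  have t2 := (tile _ i2).mul_left (Real.exp (-(2 * a * d)))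
  rw [v1] at t1
  rw [v2] at t2
  have fin : ∀ k : ZLat d, volume (cubeZ k) ≠ ⊤ := fun k => by simp [cubeZ_vol]
  have b1 : ∀ k : ZLat d, Real.exp (-a * ‖x - latVec k‖ ^ 2) ≤
      Real.exp (a * d) * ∫ y in cubeZ k, Real.exp (-(a / 2) * ‖x - y‖ ^ 2) := by
    intro k
    rw [← integral_const_mul, ← cubeZ_const k (Real.exp (-a * ‖x - latVec k‖ ^ 2))]
    refine setIntegral_mono_on ?_ ?_ (cubeZ_meas k) ?_
    · exact integrableOn_const (fin k)
    · exact (i1.const_mul _).integrableOn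
    · intro y hy
      rw [← Real.exp_add, Real.exp_le_exp]
      have h1 := cubeZ_dist k y hy
      have h2 := norm_sq_le2 (x - latVec k) (-(y - latVec k))
      rw [show x - latVec k + -(y - latVec k) = x - y by abel, norm_neg] at h2
      nlinarith
  have b2 : ∀ k : ZLat d, Real.exp (-(2 * a * d)) * ∫ y in cubeZ k, Real.exp (-(2 * a) * ‖x - y‖ ^ 2)
      ≤ Real.exp (-a * ‖x - latVec k‖ ^ 2) := by
    intro k
    rw [← integral_const_mul, ← cubeZ_const k (Real.exp (-a * ‖x - latVec k‖ ^ 2))]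
    refine setIntegral_mono_on ?_ ?_ (cubeZ_meas k) ?_
    · exact (i2.const_mul _).integrableOn
    · exact integrableOn_const (fin k)
    · intro y hy
      rw [← Real.exp_add, Real.exp_le_exp]
      have h1 := cubeZ_dist k y hy
      have h2 := norm_sq_le2 (x - y) (y - latVec k)
      rw [show x - y + (y - latVec k) = x - latVec k by abel] at h2
      nlinarith
  have hs : Summable (fun k : ZLat d => Real.exp (-a * ‖x - latVec k‖ ^ 2)) :=
    Summable.of_nonneg_of_le (fun _ => (Real.exp_pos _).le) b1 t1.summable
  refine ⟨hs, ?_, ?_⟩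
  · rw [← t1.tsum_eq]; exact hs.tsum_le_tsum b1 t1.summable
  · rw [← t2.tsum_eq]; exact t2.summable.tsum_le_tsum b2 hs

def ew {d : ℕ} (s : ℝ) (x : EE d) (k : ZLat d) : ℝ := Real.exp (-‖x - latVec k‖ ^ 2 / (2 * s))

def ZZ {d : ℕ} (s : ℝ) (x : EE d) : ℝ := ∑' k : ZLat d, ew s x k

def DD {d : ℕ} (s : ℝ) (x : EE d) (m : ZLat d) (i : Fin d) : ℝ :=
  (1 / s) * (ew s x m / ZZ s x) * ∑' k : ZLat d, (ew s x k / ZZ s x) * ((m i : ℝ) - (k i : ℝ))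

lemma ew_eq {d : ℕ} (s : ℝ) (x : EE d) (k : ZLat d) :
    ew s x k = Real.exp (-(1 / (2 * s)) * ‖x - latVec k‖ ^ 2) := by
  unfold ew; congr 1; ring

lemma ew_pos {d : ℕ} (s : ℝ) (x : EE d) (k : ZLat d) : 0 < ew s x k := Real.exp_pos _

lemma ew_summable {d : ℕ} (s : ℝ) (hs : 0 < s) (x : EE d) : Summable (ew s x) := by
  have := (gsum (1 / (2 * s)) (by positivity) x).1
  exact this.congr fun k => (ew_eq s x k).symm

lemma ZZ_pos {d : ℕ} (s : ℝ) (hs : 0 < s) (x : EE d) : 0 < ZZ s x :=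
  (ew_summable s hs x).tsum_pos (fun k => (ew_pos s x k).le) 0 (ew_pos s x 0)

lemma pHeatK_eq_s7 {d : ℕ} (s : ℝ) (x : EE d) :
    pHeatK d s x = (2 * π * s) ^ (-(d : ℝ) / 2) * ZZ s x := by
  unfold pHeatK heatK ZZ ew
  rw [tsum_mul_left]

lemma ratio_eq {d : ℕ} (s : ℝ) (hs : 0 < s) (x : EE d) (m : ZLat d) :
    heatK d s (x - latVec m) / pHeatK d s x = ew s x m / ZZ s x := by
  rw [pHeatK_eq_s7]
  unfold heatK
  rw [mul_div_mul_left]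
  · rfl
  · positivity

lemma r_le (a r : ℝ) (ha : 0 < a) : r ≤ (1 / √a) * Real.exp (a * r ^ 2) := by
  have h := Real.add_one_le_exp (a * r ^ 2)
  have h1 : √a * r ≤ a * r ^ 2 + 1 := by
    have h2 : a * r ^ 2 = (√a * r) ^ 2 := by rw [mul_pow, Real.sq_sqrt ha.le]
    rw [h2]
    nlinarith [sq_nonneg (√a * r - 1 / 2)]
  have hp : 0 < √a := Real.sqrt_pos.2 ha
  rw [one_div, ← div_eq_inv_mul, le_div_iff₀ hp]
  linarith

lemma ew_deriv {d : ℕ} (s : ℝ) (x : EE d) (k : ZLat d) :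
    HasFDerivAt (fun y : EE d => ew s y k)
      ((-(ew s x k) / s) • innerSL ℝ (x - latVec k)) x := by
  have h1 : HasFDerivAt (fun y : EE d => y - latVec k) (ContinuousLinearMap.id ℝ (EE d)) x :=
    (hasFDerivAt_id x).sub_const _
  have h2 := (h1.norm_sq.const_mul (-(1 / (2 * s)))).exp
  refine HasFDerivAt.congr_fderiv (h2.congr_of_eventuallyEq ?_) ?_
  · exact Filter.Eventually.of_forall fun y => ew_eq s y k
  · ext v
    simp [ew_eq]
    by_cases hs : s = 0
    · simp [hs]
    field_simp

lemma ew_deriv_bound {d : ℕ} (s : ℝ) (hs : 0 < s) (x0 x : EE d) (hx : x ∈ Metric.ball x0 1)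
    (k : ZLat d) :
    ‖(-(ew s x k) / s) • innerSL ℝ (x - latVec k)‖ ≤
      (1 / √(1 / (4 * s)) / s * Real.exp (1 / (4 * s))) *
        Real.exp (-(1 / (8 * s)) * ‖x0 - latVec k‖ ^ 2) := by
  rw [norm_smul, innerSL_apply_norm, norm_div, norm_neg, Real.norm_of_nonneg (ew_pos s x k).le,
    Real.norm_of_nonneg hs.le]
  have h1 := r_le (1 / (4 * s)) ‖x - latVec k‖ (by positivity)
  have h2 : ‖x0 - latVec k‖ ^ 2 ≤ 2 * ‖x - latVec k‖ ^ 2 + 2 := by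
    have h3 := norm_sq_le2 (x - latVec k) (x0 - x)
    rw [show x - latVec k + (x0 - x) = x0 - latVec k by abel] at h3
    have h4 : ‖x0 - x‖ < 1 := by rw [← dist_eq_norm, dist_comm]; exact hx
    nlinarith [norm_nonneg (x0 - x)]
  calc ew s x k / s * ‖x - latVec k‖
      ≤ ew s x k / s * ((1 / √(1 / (4 * s))) * Real.exp (1 / (4 * s) * ‖x - latVec k‖ ^ 2)) := by
        have := ew_pos s x k
        gcongr
    _ = 1 / √(1 / (4 * s)) / s * (Real.exp (-(1 / (2 * s)) * ‖x - latVec k‖ ^ 2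
          + 1 / (4 * s) * ‖x - latVec k‖ ^ 2)) := by
        rw [ew_eq, Real.exp_add]; ring
    _ ≤ 1 / √(1 / (4 * s)) / s * Real.exp (1 / (4 * s) + -(1 / (8 * s)) * ‖x0 - latVec k‖ ^ 2) := by
        refine mul_le_mul_of_nonneg_left (Real.exp_le_exp.2 ?_) (by positivity)
        have : -(1 / (2 * s)) * ‖x - latVec k‖ ^ 2 + 1 / (4 * s) * ‖x - latVec k‖ ^ 2
          = (1 / (8 * s)) * (- 2 * ‖x - latVec k‖ ^ 2) := by field_simp; ring
        rw [this]
        have : 1 / (4 * s) + -(1 / (8 * s)) * ‖x0 - latVec k‖ ^ 2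
          = (1 / (8 * s)) * (2 - ‖x0 - latVec k‖ ^ 2) := by field_simp; ring
        rw [this]
        gcongr
        linarith
    _ = _ := by rw [Real.exp_add]; ring

lemma deriv_summable {d : ℕ} (s : ℝ) (hs : 0 < s) (x : EE d) :
    Summable fun k : ZLat d => (-(ew s x k) / s) • innerSL ℝ (x - latVec k) := by
  refine Summable.of_norm_bounded ((gsum (1 / (8 * s)) (by positivity) x).1.mul_left
    (1 / √(1 / (4 * s)) / s * Real.exp (1 / (4 * s)))) fun k => ?_
  exact ew_deriv_bound s hs x x (by simp) k

lemma ZZ_deriv {d : ℕ} (s : ℝ) (hs : 0 < s) (x : EE d) :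
    HasFDerivAt (fun y : EE d => ZZ s y)
      (∑' k : ZLat d, (-(ew s x k) / s) • innerSL ℝ (x - latVec k)) x := by
  have hu := (gsum (1 / (8 * s)) (by positivity) x).1.mul_left
    (1 / √(1 / (4 * s)) / s * Real.exp (1 / (4 * s)))
  exact hasFDerivAt_tsum_of_isPreconnected hu Metric.isOpen_ball
    (convex_ball x 1).isPreconnected (fun k y _ => ew_deriv s y k)
    (fun k y hy => ew_deriv_bound s hs x y hy k) (Metric.mem_ball_self one_pos)
    (ew_summable s hs x) (Metric.mem_ball_self one_pos)

lemma inner_single' {d : ℕ} (u : EE d) (i : Fin d) :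
    innerSL ℝ u (EuclideanSpace.single i 1) = u i := by
  simp [EuclideanSpace.inner_single_right]

lemma moment_summable {d : ℕ} (s : ℝ) (hs : 0 < s) (x : EE d) (i : Fin d) :
    Summable fun k : ZLat d => ew s x k * (x i - k i) := by
  have h := (deriv_summable s hs x).map
    (ContinuousLinearMap.apply ℝ ℝ (EuclideanSpace.single i (1:ℝ))) (by fun_prop)
  refine (h.mul_left (-s)).congr fun k => ?_
  simp only [Function.comp, ContinuousLinearMap.apply_apply, ContinuousLinearMap.smul_apply,
    inner_single', smul_eq_mul]
  simp only [latVec, PiLp.sub_apply]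
  field_simp

lemma pderiv_eq {d : ℕ} (s : ℝ) (hs : 0 < s) (x : EE d) (m : ZLat d) (i : Fin d) :
    pderiv i (fun y => heatK d s (y - latVec m) / pHeatK d s y) x = DD s x m i := by
  have hZ := ZZ_pos s hs x
  have h1 : (fun y => heatK d s (y - latVec m) / pHeatK d s y) =
      fun y : EE d => ew s y m * (ZZ s y)⁻¹ := by
    funext y; rw [ratio_eq s hs, div_eq_mul_inv]
  have hinv := ((hasDerivAt_inv hZ.ne').comp_hasFDerivAt x (ZZ_deriv s hs x))
  have h2 := (ew_deriv s x m).mul hinv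
  have h3 : HasFDerivAt (fun y : EE d => ew s y m * (ZZ s y)⁻¹) _ x := h2
  have e1 : (∑' k : ZLat d, (-(ew s x k) / s) • innerSL ℝ (x - latVec k))
      (EuclideanSpace.single i 1) = -(1 / s) * ∑' k : ZLat d, ew s x k * (x i - k i) := by
    have := ContinuousLinearMap.map_tsum
      (ContinuousLinearMap.apply ℝ ℝ (EuclideanSpace.single i (1:ℝ))) (deriv_summable s hs x)
    simp only [ContinuousLinearMap.apply_apply] at this
    rw [this, ← tsum_mul_left]
    refine tsum_congr fun k => ?_
    simp only [ContinuousLinearMap.smul_apply, inner_single', smul_eq_mul]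
    simp only [latVec, PiLp.sub_apply]
    ring
  have e2 : ∑' k : ZLat d, (ew s x k / ZZ s x) * ((m i : ℝ) - (k i : ℝ)) =
      (∑' k : ZLat d, ew s x k * (x i - k i)) / ZZ s x - (x i - m i) := by
    have : ∀ k : ZLat d, (ew s x k / ZZ s x) * ((m i : ℝ) - (k i : ℝ)) =
      (ew s x k * (x i - k i)) / ZZ s x - ew s x k * ((x i - m i) / ZZ s x) := by intro k; ring
    simp_rw [this]
    rw [Summable.tsum_sub ((moment_summable s hs x i).div_const _)
      ((ew_summable s hs x).mul_right _), tsum_div_const, tsum_mul_right]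
    congr 1
    change ZZ s x * _ = _
    field_simp
  unfold pderiv
  rw [h1, h3.fderiv]
  simp only [ContinuousLinearMap.add_apply, ContinuousLinearMap.smul_apply, e1, smul_eq_mul,
    inner_single']
  unfold DD
  rw [e2]
  simp only [latVec, PiLp.sub_apply, Function.comp]
  generalize (∑' k : ZLat d, ew s x k * (x i - k i)) = S
  field_simp
  ring

def RR {d : ℕ} (s : ℝ) (x : EE d) (m : ZLat d) : ℝ :=
  (1 / s) * (ew s x m / ZZ s x) * ∑' k : ZLat d, (ew s x k / ZZ s x) * ‖latVec m - latVec k‖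

lemma lat_tri {d : ℕ} (x : EE d) (m k : ZLat d) :
    ‖latVec m - latVec k‖ ≤ ‖x - latVec m‖ + ‖x - latVec k‖ := by
  have := norm_sub_le (x - latVec k) (x - latVec m)
  rw [show x - latVec k - (x - latVec m) = latVec m - latVec k by abel] at this
  linarith

lemma lat_coord {d : ℕ} (m k : ZLat d) (i : Fin d) :
    |(m i : ℝ) - (k i : ℝ)| ≤ ‖latVec m - latVec k‖ := by
  have := PiLp.norm_apply_le (latVec m - latVec k) i
  simpa [latVec] using this

lemma lat_sep {d : ℕ} (m k : ZLat d) (h : m ≠ k) : 1 ≤ ‖latVec m - latVec k‖ := by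
  obtain ⟨i, hi⟩ := Function.ne_iff.1 h
  refine le_trans ?_ (lat_coord m k i)
  have : 1 ≤ |m i - k i| := Int.one_le_abs (sub_ne_zero.2 hi)
  exact_mod_cast this

lemma term_bd {d : ℕ} (s : ℝ) (hs : 0 < s) (x : EE d) (m k : ZLat d) :
    ew s x k * ‖latVec m - latVec k‖ ≤ (4 * √s * Real.exp (1 / (4 * s) * ‖x - latVec m‖ ^ 2)) *
      Real.exp (-(1 / (4 * s)) * ‖x - latVec k‖ ^ 2) := by
  have hq : 1 / √(1 / (4 * s)) = 2 * √s := by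
    rw [Real.sqrt_div one_pos.le, Real.sqrt_one, one_div_one_div, Real.sqrt_mul (by norm_num),
      show (4 : ℝ) = 2 ^ 2 by norm_num, Real.sqrt_sq (by norm_num)]
  have h1 := r_le (1 / (4 * s)) ‖x - latVec m‖ (by positivity)
  have h2 := r_le (1 / (4 * s)) ‖x - latVec k‖ (by positivity)
  rw [hq] at h1 h2
  have h3 := lat_tri x m k
  set A := Real.exp (1 / (4 * s) * ‖x - latVec m‖ ^ 2)
  set B := Real.exp (1 / (4 * s) * ‖x - latVec k‖ ^ 2) with hB
  have hA1 : 1 ≤ A := Real.one_le_exp (by positivity)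
  have hB1 : 1 ≤ B := Real.one_le_exp (by positivity)
  have h4 : ‖latVec m - latVec k‖ ≤ 4 * √s * (A * B) := by
    have := Real.sqrt_nonneg s
    have e1 : A ≤ A * B := by nlinarith
    have e2 : B ≤ A * B := by nlinarith
    nlinarith [mul_le_mul_of_nonneg_left e1 this, mul_le_mul_of_nonneg_left e2 this]
  have h5 : ew s x k * B = Real.exp (-(1 / (4 * s)) * ‖x - latVec k‖ ^ 2) := by
    rw [ew_eq, hB, ← Real.exp_add]; congr 1; field_simp; ring
  calc _ ≤ ew s x k * (4 * √s * (A * B)) := by have := ew_pos s x k; gcongr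
    _ = 4 * √s * A * (ew s x k * B) := by ring
    _ = _ := by rw [h5]

lemma mom_summable {d : ℕ} (s : ℝ) (hs : 0 < s) (x : EE d) (m : ZLat d) :
    Summable fun k : ZLat d => ew s x k * ‖latVec m - latVec k‖ :=
  Summable.of_nonneg_of_le (fun k => mul_nonneg (ew_pos s x k).le (norm_nonneg _))
    (term_bd s hs x m) ((gsum (1 / (4 * s)) (by positivity) x).1.mul_left _)

lemma gmom_summable {d : ℕ} (s : ℝ) (hs : 0 < s) (x : EE d) (m : ZLat d) :
    Summable fun k : ZLat d => ew s x k / ZZ s x * ‖latVec m - latVec k‖ :=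
  ((mom_summable s hs x m).div_const (ZZ s x)).congr fun k => by ring

lemma RR_eq {d : ℕ} (s : ℝ) (x : EE d) (m : ZLat d) :
    RR s x m = (1 / s) * ew s x m * (∑' k : ZLat d, ew s x k * ‖latVec m - latVec k‖)
      / ZZ s x ^ 2 := by
  unfold RR
  have : ∀ k : ZLat d, ew s x k / ZZ s x * ‖latVec m - latVec k‖ =
    ew s x k * ‖latVec m - latVec k‖ / ZZ s x := fun k => by ring
  simp_rw [this]
  rw [tsum_div_const]
  ring

lemma RR_nonneg {d : ℕ} (s : ℝ) (hs : 0 < s) (x : EE d) (m : ZLat d) : 0 ≤ RR s x m := by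
  rw [RR_eq]
  have := ew_pos s x m
  have h : 0 ≤ ∑' k : ZLat d, ew s x k * ‖latVec m - latVec k‖ :=
    tsum_nonneg fun k => mul_nonneg (ew_pos s x k).le (norm_nonneg _)
  positivity

lemma DD_le {d : ℕ} (s : ℝ) (hs : 0 < s) (x : EE d) (m : ZLat d) (i : Fin d) :
    |DD s x m i| ≤ RR s x m := by
  have hZ := ZZ_pos s hs x
  have he := ew_pos s x m
  unfold DD RR
  rw [abs_mul, abs_of_nonneg (by positivity : 0 ≤ 1 / s * (ew s x m / ZZ s x))]
  refine mul_le_mul_of_nonneg_left ?_ (by positivity)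
  rw [← Real.norm_eq_abs]
  refine tsum_of_norm_bounded (gmom_summable s hs x m).hasSum fun k => ?_
  have hk := ew_pos s x k
  rw [norm_mul, Real.norm_of_nonneg (by positivity), Real.norm_eq_abs]
  have := lat_coord m k i
  gcongr

lemma ZZ_ge {d : ℕ} (s : ℝ) (hs : 1 ≤ s) (x : EE d) :
    Real.exp (-d) * s ^ ((d : ℝ) / 2) ≤ ZZ s x := by
  have hs0 : 0 < s := by linarith
  have h := (gsum (1 / (2 * s)) (by positivity) x).2.2
  have e : ∑' k : ZLat d, Real.exp (-(1 / (2 * s)) * ‖x - latVec k‖ ^ 2) = ZZ s x :=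
    tsum_congr fun k => (ew_eq s x k).symm
  rw [e] at h
  refine le_trans ?_ h
  have h1 : 2 * (1 / (2 * s)) * d ≤ d := by
    rw [show 2 * (1 / (2 * s)) * (d:ℝ) = d / s by field_simp]
    exact div_le_self (by positivity) hs
  have h2 : s ≤ π / (2 * (1 / (2 * s))) := by
    rw [show π / (2 * (1 / (2 * s))) = π * s by field_simp]
    nlinarith [Real.pi_gt_three]
  gcongr

lemma gsum_le {d : ℕ} (c s : ℝ) (hc : 1 ≤ c) (hs : 1 ≤ s) (x : EE d) :
    ∑' k : ZLat d, Real.exp (-(1 / (c * s)) * ‖x - latVec k‖ ^ 2) ≤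
     Real.exp d * (2 * π * c) ^ ((d : ℝ) / 2) * s ^ ((d : ℝ) / 2) := by
  have hs0 : 0 < s := by linarith
  have hc0 : 0 < c := by linarith
  have h := (gsum (1 / (c * s)) (by positivity) x).2.1
  refine le_trans h ?_
  rw [mul_assoc, ← Real.mul_rpow (by positivity) (by positivity)]
  have h1 : 1 / (c * s) * d ≤ d := by
    rw [show 1 / (c * s) * (d:ℝ) = d / (c * s) by field_simp]
    exact div_le_self (by positivity) (by nlinarith)
  have h2 : π / (1 / (c * s) / 2) = 2 * π * c * s := by field_simp
  rw [h2]
  gcongr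

lemma RR_large (d : ℕ) : ∃ C : ℝ, 0 ≤ C ∧ ∀ (s : ℝ), 1 ≤ s → ∀ (x : EE d) (m : ZLat d),
    RR s x m ≤ C * (√s / (s * s ^ ((d : ℝ) / 2))) *
      Real.exp (-(1 / (4 * s)) * ‖x - latVec m‖ ^ 2) := by
  refine ⟨4 * (Real.exp d * (2 * π * 4) ^ ((d : ℝ) / 2)) / (Real.exp (-d)) ^ 2,
    by positivity, ?_⟩
  intro s hs x m
  have hs0 : 0 < s := by linarith
  have hZ := ZZ_ge s hs x
  have hU := gsum_le 4 s (by norm_num) hs x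
  rw [RR_eq]
  set q := s ^ ((d : ℝ) / 2) with hq
  have hq0 : 0 < q := by positivity
  set c1 := Real.exp d * (2 * π * 4) ^ ((d : ℝ) / 2) with hc1
  have hc10 : 0 < c1 := by positivity
  have hS : ∑' k : ZLat d, ew s x k * ‖latVec m - latVec k‖ ≤
      (4 * √s * Real.exp (1 / (4 * s) * ‖x - latVec m‖ ^ 2)) * (c1 * q) := by
    refine le_trans ((mom_summable s hs0 x m).tsum_le_tsum (term_bd s hs0 x m)
      ((gsum (1 / (4 * s)) (by positivity) x).1.mul_left _)) ?_
    rw [tsum_mul_left]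
    gcongr
  have he : ew s x m * Real.exp (1 / (4 * s) * ‖x - latVec m‖ ^ 2) =
      Real.exp (-(1 / (4 * s)) * ‖x - latVec m‖ ^ 2) := by
    rw [ew_eq, ← Real.exp_add]; congr 1; field_simp; ring
  have hem := ew_pos s x m
  calc _ ≤ 1 / s * ew s x m * ((4 * √s * Real.exp (1 / (4 * s) * ‖x - latVec m‖ ^ 2)) * (c1 * q))
        / (Real.exp (-d) * q) ^ 2 := by gcongr
    _ = 1 / s * (ew s x m * Real.exp (1 / (4 * s) * ‖x - latVec m‖ ^ 2)) * (4 * √s * (c1 * q))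
        / (Real.exp (-d) * q) ^ 2 := by ring
    _ = _ := by rw [he]; field_simp

lemma pHeatK_large (d : ℕ) : ∃ C : ℝ, 0 ≤ C ∧ ∀ (s : ℝ), 1 ≤ s → ∀ (x : EE d),
    pHeatK d s x ≤ C := by
  refine ⟨(2 * π) ^ (-(d : ℝ) / 2) * (Real.exp d * (2 * π * 2) ^ ((d : ℝ) / 2)), by positivity, ?_⟩
  intro s hs x
  have hs0 : 0 < s := by linarith
  have hU := gsum_le 2 s (by norm_num) hs x
  have e : ∑' k : ZLat d, Real.exp (-(1 / (2 * s)) * ‖x - latVec k‖ ^ 2) = ZZ s x :=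
    tsum_congr fun k => (ew_eq s x k).symm
  rw [e] at hU
  rw [pHeatK_eq_s7, Real.mul_rpow (by positivity) hs0.le]
  have h1 : s ^ (-(d : ℝ) / 2) * s ^ ((d : ℝ) / 2) = 1 := by
    rw [← Real.rpow_add hs0, show -(d : ℝ) / 2 + (d : ℝ) / 2 = 0 by ring, Real.rpow_zero]
  calc _ ≤ (2 * π) ^ (-(d : ℝ) / 2) * s ^ (-(d : ℝ) / 2) *
        (Real.exp d * (2 * π * 2) ^ ((d : ℝ) / 2) * s ^ ((d : ℝ) / 2)) := by gcongr
    _ = (2 * π) ^ (-(d : ℝ) / 2) * (Real.exp d * (2 * π * 2) ^ ((d : ℝ) / 2)) *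
        (s ^ (-(d : ℝ) / 2) * s ^ ((d : ℝ) / 2)) := by ring
    _ = _ := by rw [h1, mul_one]

lemma pHeatK_pos_s7 {d : ℕ} (s : ℝ) (hs : 0 < s) (x : EE d) : 0 < pHeatK d s x := by
  rw [pHeatK_eq_s7]; have := ZZ_pos s hs x; positivity

lemma GG_large (d : ℕ) : ∃ C : ℝ, 0 ≤ C ∧ ∀ (s : ℝ), 1 ≤ s → ∀ (x : EE d) (m n : ZLat d),
    pHeatK d s x * (RR s x m * RR s x n) ≤ C / s ^ (d + 1) *
      Real.exp (-(1 / (4 * s)) * ‖x - latVec m‖ ^ 2) := by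
  obtain ⟨C1, hC1, h1⟩ := RR_large d
  obtain ⟨C2, hC2, h2⟩ := pHeatK_large d
  refine ⟨C2 * (C1 * C1), by positivity, fun s hs x m n => ?_⟩
  have hs0 : 0 < s := by linarith
  have a1 := h1 s hs x m
  have a2 : RR s x n ≤ C1 * (√s / (s * s ^ ((d : ℝ) / 2))) := by
    refine (h1 s hs x n).trans ?_
    refine mul_le_of_le_one_right (by positivity) (Real.exp_le_one_iff.2 ?_)
    have : 0 ≤ 1 / (4 * s) * ‖x - latVec n‖ ^ 2 := by positivity
    linarith
  have hk : (√s / (s * s ^ ((d : ℝ) / 2))) * (√s / (s * s ^ ((d : ℝ) / 2))) = 1 / s ^ (d + 1) := by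
    rw [div_mul_div_comm, Real.mul_self_sqrt hs0.le]
    have : s ^ ((d : ℝ) / 2) * s ^ ((d : ℝ) / 2) = s ^ d := by
      rw [← Real.rpow_add hs0, add_halves, Real.rpow_natCast]
    rw [show s * s ^ ((d : ℝ) / 2) * (s * s ^ ((d : ℝ) / 2)) = s * s * (s ^ ((d : ℝ) / 2) *
      s ^ ((d : ℝ) / 2)) by ring, this]
    field_simp
    ring
  have := RR_nonneg s hs0 x m
  have := RR_nonneg s hs0 x n
  have := h2 s hs x
  calc _ ≤ C2 * ((C1 * (√s / (s * s ^ ((d : ℝ) / 2))) *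
      Real.exp (-(1 / (4 * s)) * ‖x - latVec m‖ ^ 2)) * (C1 * (√s / (s * s ^ ((d : ℝ) / 2))))) := by
        gcongr
    _ = C2 * (C1 * C1) * ((√s / (s * s ^ ((d : ℝ) / 2))) * (√s / (s * s ^ ((d : ℝ) / 2)))) *
      Real.exp (-(1 / (4 * s)) * ‖x - latVec m‖ ^ 2) := by ring
    _ = _ := by rw [hk]; ring

lemma dbl {ι : Type*} (a b v : ι → ℝ) (w c : ℝ) (ha : Summable a) (hb : Summable b)
    (hv : Summable v) (h : ∀ k l, w * a k * b l ≤ c * v k * v l) :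
    w * (∑' k, a k) * (∑' l, b l) ≤ c * (∑' k, v k) * (∑' k, v k) := by
  have h1 : ∀ k, w * a k * (∑' l, b l) ≤ c * v k * ∑' l, v l := fun k => by
    rw [← tsum_mul_left, ← tsum_mul_left]
    exact (hb.mul_left _).tsum_le_tsum (h k) (hv.mul_left _)
  have h2 := ((ha.mul_left w).mul_right _).tsum_le_tsum h1 ((hv.mul_left c).mul_right _)
  rwa [tsum_mul_right, tsum_mul_right, tsum_mul_left, tsum_mul_left] at h2

lemma ew_le_ZZ {d : ℕ} (s : ℝ) (hs : 0 < s) (x : EE d) (k : ZLat d) : ew s x k ≤ ZZ s x :=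
  (ew_summable s hs x).le_tsum k fun j _ => (ew_pos s x j).le

lemma three_bd (p Z : ℝ) (hp : 0 ≤ p) (hZ : 0 < Z) (h : p ^ 3 ≤ Z ^ 3) : p ^ 3 / Z ^ 2 ≤ p := by
  have h1 : p ≤ Z := le_of_pow_le_pow_left₀ (by norm_num) hZ.le h
  rw [div_le_iff₀ (by positivity)]
  calc p ^ 3 = p * p ^ 2 := by ring
    _ ≤ p * Z ^ 2 := by gcongr

lemma small_term {d : ℕ} (s : ℝ) (hs : 0 < s) (hs1 : s ≤ 1) (x : EE d) (m n k l : ZLat d) :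
    (ZZ s x * (ew s x m / ZZ s x)) * (ew s x k / ZZ s x * ‖latVec m - latVec k‖) *
      (ew s x l / ZZ s x * ‖latVec n - latVec l‖) ≤
    (14 * (14 + ‖latVec m - latVec n‖) * Real.exp (-(1 / (24 * s))) *
      Real.exp (-(1 / 24) * ‖x - latVec m‖ ^ 2)) *
      Real.exp (-(1 / 16) * ‖x - latVec k‖ ^ 2) * Real.exp (-(1 / 16) * ‖x - latVec l‖ ^ 2) := by
  have hZ := ZZ_pos s hs x
  by_cases hmk : m = k
  · subst hmk
    simp only [sub_self, norm_zero, mul_zero, zero_mul]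
    positivity
  have hsep := lat_sep m k hmk
  have htri := lat_tri x m k
  have htri2 : ‖latVec n - latVec l‖ ≤ ‖latVec m - latVec n‖ + (‖x - latVec m‖ + ‖x - latVec l‖) := by
    have h1 := lat_tri x m l
    have h2 := norm_sub_le (latVec m - latVec l) (latVec m - latVec n)
    rw [show latVec m - latVec l - (latVec m - latVec n) = latVec n - latVec l by abel] at h2
    linarith
  have hem := ew_pos s x m
  have hek := ew_pos s x k
  have hel := ew_pos s x l
  have hme := ew_le_ZZ s hs x m
  have hke := ew_le_ZZ s hs x k
  have hle := ew_le_ZZ s hs x l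
  set D := ‖latVec m - latVec n‖ with hD
  have hD0 : 0 ≤ D := norm_nonneg _
  set a := ‖x - latVec m‖ with ha
  set b := ‖x - latVec k‖ with hb
  set c := ‖x - latVec l‖ with hc
  have ha0 : 0 ≤ a := norm_nonneg _
  have hb0 : 0 ≤ b := norm_nonneg _
  have hc0 : 0 ≤ c := norm_nonneg _
  have hp3 : (Real.exp (-(a ^ 2 + b ^ 2 + c ^ 2) / (6 * s))) ^ 3 = ew s x m * ew s x k * ew s x l := by
    rw [ew_eq, ew_eq, ew_eq, ← Real.exp_add, ← Real.exp_add, ← Real.exp_nat_mul]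
    congr 1
    push_cast
    field_simp
    ring
  set p := Real.exp (-(a ^ 2 + b ^ 2 + c ^ 2) / (6 * s)) with hp
  have key : ew s x m * ew s x k * ew s x l / ZZ s x ^ 2 ≤ p := by
    rw [← hp3]
    refine three_bd p _ (Real.exp_pos _).le hZ ?_
    rw [hp3, pow_three, ← mul_assoc]
    gcongr
  have hr : ∀ r : ℝ, r ≤ 7 * Real.exp (1 / 48 * r ^ 2) := fun r => by
    refine (r_le (1 / 48) r (by norm_num)).trans ?_
    have : 1 / √(1 / 48 : ℝ) ≤ 7 := by
      rw [div_le_iff₀ (by positivity)]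
      have : (1 / 7 : ℝ) ≤ √(1 / 48) := Real.le_sqrt_of_sq_le (by norm_num)
      linarith
    gcongr
  have hsum : ∀ r t : ℝ, r + t ≤ 14 * Real.exp (1 / 48 * (r ^ 2 + t ^ 2)) := fun r t => by
    have e1 : Real.exp (1 / 48 * r ^ 2) ≤ Real.exp (1 / 48 * (r ^ 2 + t ^ 2)) := by
      apply Real.exp_le_exp.2; nlinarith [sq_nonneg t]
    have e2 : Real.exp (1 / 48 * t ^ 2) ≤ Real.exp (1 / 48 * (r ^ 2 + t ^ 2)) := by
      apply Real.exp_le_exp.2; nlinarith [sq_nonneg r]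
    linarith [hr r, hr t]
  have b1 : ‖latVec m - latVec k‖ ≤ 14 * Real.exp (1 / 48 * (a ^ 2 + b ^ 2)) :=
    htri.trans (hsum a b)
  have b2 : ‖latVec n - latVec l‖ ≤ (14 + D) * Real.exp (1 / 48 * (a ^ 2 + c ^ 2)) := by
    have : 1 ≤ Real.exp (1 / 48 * (a ^ 2 + c ^ 2)) := Real.one_le_exp (by positivity)
    nlinarith [hsum a c]
  have hab : 1 / 2 ≤ a ^ 2 + b ^ 2 := by nlinarith [sq_nonneg (a - b)]
  have hexp : -(a ^ 2 + b ^ 2 + c ^ 2) / (6 * s) ≤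
      -(1 / (24 * s)) + -(1 / 12) * (a ^ 2 + b ^ 2 + c ^ 2) := by
    have h1 : 1 ≤ 1 / s := by rw [le_div_iff₀ hs]; linarith
    have h2 : -(a ^ 2 + b ^ 2 + c ^ 2) / (6 * s) = -(a ^ 2 + b ^ 2 + c ^ 2) / 6 * (1 / s) := by
      field_simp
    have h3 : 1 / (24 * s) = 1 / 24 * (1 / s) := by field_simp
    rw [h2, h3]
    nlinarith [mul_nonneg (sub_nonneg.2 hab) (by linarith : (0:ℝ) ≤ 1 / s),
      mul_nonneg (by positivity : 0 ≤ a ^ 2 + b ^ 2 + c ^ 2) (sub_nonneg.2 h1),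
      mul_nonneg (sq_nonneg c) (by linarith : (0:ℝ) ≤ 1 / s)]
  calc _ = (ew s x m * ew s x k * ew s x l / ZZ s x ^ 2) * ‖latVec m - latVec k‖ *
        ‖latVec n - latVec l‖ := by field_simp
    _ ≤ Real.exp (-(1 / (24 * s)) + -(1 / 12) * (a ^ 2 + b ^ 2 + c ^ 2)) *
        (14 * Real.exp (1 / 48 * (a ^ 2 + b ^ 2))) *
        ((14 + D) * Real.exp (1 / 48 * (a ^ 2 + c ^ 2))) := by
        have := key.trans (Real.exp_le_exp.2 hexp)
        gcongr
    _ = (14 * (14 + D)) * Real.exp (-(1 / (24 * s)) + -(1 / 12) * (a ^ 2 + b ^ 2 + c ^ 2) +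
        1 / 48 * (a ^ 2 + b ^ 2) + 1 / 48 * (a ^ 2 + c ^ 2)) := by
        simp only [Real.exp_add]; ring
    _ = (14 * (14 + D)) * Real.exp (-(1 / (24 * s)) + -(1 / 24) * a ^ 2 + -(1 / 16) * b ^ 2 +
        -(1 / 16) * c ^ 2) := by congr 2; ring
    _ = _ := by
        rw [Real.exp_add, Real.exp_add, Real.exp_add]; ring

lemma GG_small {d : ℕ} (m n : ZLat d) : ∃ C : ℝ, 0 ≤ C ∧ ∀ (s : ℝ), 0 < s → s ≤ 1 → ∀ (x : EE d),
    pHeatK d s x * (RR s x m * RR s x n) ≤ C * Real.exp (-(1 / 24) * ‖x - latVec m‖ ^ 2) := by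
  set V0 := Real.exp (1 / 16 * d) * (π / (1 / 16 / 2)) ^ ((d : ℝ) / 2) with hV0
  have hV00 : 0 < V0 := by positivity
  set c0 := 14 * (14 + ‖(latVec m - latVec n : EE d)‖) with hc0
  have hc00 : 0 < c0 := by positivity
  refine ⟨(24 ^ (d + 2) * (d + 2).factorial) * (c0 * V0 * V0), by positivity, ?_⟩
  intro s hs hs1 x
  have hZ := ZZ_pos s hs x
  obtain ⟨hv, hV, -⟩ := gsum (1 / 16) (by norm_num) x
  have h1 := dbl _ _ _ _ _ (gmom_summable s hs x m) (gmom_summable s hs x n) hv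
    (small_term s hs hs1 x m n)
  set S1 := ∑' k : ZLat d, ew s x k / ZZ s x * ‖latVec m - latVec k‖ with hS1
  set S2 := ∑' k : ZLat d, ew s x k / ZZ s x * ‖latVec n - latVec k‖ with hS2
  set V := ∑' k : ZLat d, Real.exp (-(1 / 16) * ‖x - latVec k‖ ^ 2) with hVd
  have hVn : 0 ≤ V := tsum_nonneg fun k => (Real.exp_pos _).le
  have hS10 : 0 ≤ S1 := tsum_nonneg fun k => by have := ew_pos s x k; positivity
  have hS20 : 0 ≤ S2 := tsum_nonneg fun k => by have := ew_pos s x k; positivity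
  have hgn : ew s x n / ZZ s x ≤ 1 := (div_le_one hZ).2 (ew_le_ZZ s hs x n)
  have hpow : (2 * π * s) ^ (-(d : ℝ) / 2) ≤ (1 / s) ^ d := by
    have hx1 : 1 ≤ 1 / s := by rw [le_div_iff₀ hs]; linarith
    calc (2 * π * s) ^ (-(d : ℝ) / 2) ≤ s ^ (-(d : ℝ) / 2) := by
          refine Real.rpow_le_rpow_of_nonpos hs (by nlinarith [Real.pi_gt_three]) ?_
          have : (0:ℝ) ≤ d := by positivity
          linarith
      _ = (1 / s) ^ ((d : ℝ) / 2) := by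
          rw [one_div, Real.inv_rpow hs.le, ← Real.rpow_neg hs.le]; congr 1; ring
      _ ≤ (1 / s) ^ (d : ℝ) := by
          refine Real.rpow_le_rpow_of_exponent_le hx1 ?_
          have : (0:ℝ) ≤ d := by positivity
          linarith
      _ = _ := Real.rpow_natCast _ _
  have hfac : (1 / s) ^ (d + 2) * Real.exp (-(1 / (24 * s))) ≤ 24 ^ (d + 2) * (d + 2).factorial := by
    have h := Real.pow_div_factorial_le_exp (x := 1 / (24 * s)) (by positivity) (d + 2)
    rw [div_le_iff₀ (by positivity)] at h
    have e : (1 / s) ^ (d + 2) = 24 ^ (d + 2) * (1 / (24 * s)) ^ (d + 2) := by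
      rw [← mul_pow]; congr 1; field_simp
    rw [e, Real.exp_neg, ← div_eq_mul_inv, div_le_iff₀ (Real.exp_pos _)]
    calc _ ≤ 24 ^ (d + 2) * (Real.exp (1 / (24 * s)) * (d + 2).factorial) := by gcongr
      _ = _ := by ring
  have hem := ew_pos s x m
  have hen := ew_pos s x n
  set E := Real.exp (-(1 / 24) * ‖x - latVec m‖ ^ 2) with hE
  have hE0 : 0 < E := Real.exp_pos _
  calc pHeatK d s x * (RR s x m * RR s x n)
      = (2 * π * s) ^ (-(d : ℝ) / 2) * (1 / s) ^ 2 * ((ZZ s x * (ew s x m / ZZ s x)) * S1 * S2) *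
        (ew s x n / ZZ s x) := by
        rw [pHeatK_eq_s7]; unfold RR; rw [← hS1, ← hS2]; ring
    _ ≤ (2 * π * s) ^ (-(d : ℝ) / 2) * (1 / s) ^ 2 * ((ZZ s x * (ew s x m / ZZ s x)) * S1 * S2) :=
        mul_le_of_le_one_right (by positivity) hgn
    _ ≤ (1 / s) ^ d * (1 / s) ^ 2 * (c0 * Real.exp (-(1 / (24 * s))) * E * V * V) := by
        gcongr
    _ ≤ (1 / s) ^ d * (1 / s) ^ 2 * (c0 * Real.exp (-(1 / (24 * s))) * E * V0 * V0) := by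
        gcongr
    _ = ((1 / s) ^ (d + 2) * Real.exp (-(1 / (24 * s)))) * (c0 * V0 * V0) * E := by ring
    _ ≤ _ := by gcongr

lemma heatK_int (d : ℕ) (t : ℝ) (ht : 0 < t) :
    Integrable (fun x : EE d => heatK d t x) ∧ ∫ x : EE d, heatK d t x = 1 := by
  obtain ⟨h1, h2⟩ := gint (d := d) (1 / (2 * t)) (by positivity) 0
  have e : (fun x : EE d => heatK d t x) = fun x => (2 * π * t) ^ (-(d : ℝ) / 2) *
      Real.exp (-(1 / (2 * t)) * ‖0 - x‖ ^ 2) := by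
    funext x; unfold heatK; rw [zero_sub, norm_neg]; congr 2; ring
  rw [e]
  refine ⟨h1.const_mul _, ?_⟩
  rw [integral_const_mul, h2, show π / (1 / (2 * t)) = 2 * π * t by field_simp,
    ← Real.rpow_add (by positivity), show -(d : ℝ) / 2 + (d : ℝ) / 2 = 0 by ring, Real.rpow_zero]

lemma heatK_nonneg (d : ℕ) (t : ℝ) (ht : 0 < t) (x : EE d) : 0 ≤ heatK d t x := by
  unfold heatK; positivity

lemma heatK_scaled (d : ℕ) (T t : ℝ) (hT : 0 < T) (ht : 0 < t) (x : EE d) :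
    (2 * π * T) ^ ((d : ℝ) / 2) * heatK d t x =
      (T / t) ^ ((d : ℝ) / 2) * Real.exp (-‖x‖ ^ 2 / (2 * t)) := by
  unfold heatK
  rw [← mul_assoc]
  congr 1
  rw [show -(d : ℝ) / 2 = -((d : ℝ) / 2) by ring, Real.rpow_neg (by positivity), ← div_eq_mul_inv,
    ← Real.div_rpow (by positivity) (by positivity)]
  congr 1
  field_simp

lemma heatK_scaled_le (d : ℕ) (T s : ℝ) (hs : 0 < s) (hT : 2 * s ≤ T) (x : EE d) :
    (2 * π * T) ^ ((d : ℝ) / 2) * heatK d (T - s) x ≤ 2 ^ ((d : ℝ) / 2) := by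
  have ht : 0 < T - s := by linarith
  rw [heatK_scaled d T (T - s) (by linarith) ht]
  have h1 : T / (T - s) ≤ 2 := by rw [div_le_iff₀ ht]; linarith
  have h2 : Real.exp (-‖x‖ ^ 2 / (2 * (T - s))) ≤ 1 := by
    rw [Real.exp_le_one_iff]
    exact div_nonpos_of_nonpos_of_nonneg (by nlinarith [sq_nonneg ‖x‖]) (by linarith)
  have h0 : 0 ≤ T / (T - s) := div_nonneg (by linarith) ht.le
  calc _ ≤ (2:ℝ) ^ ((d : ℝ) / 2) * 1 := by gcongr
    _ = _ := mul_one _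

lemma heatK_scaled_tendsto (d : ℕ) (s : ℝ) (x : EE d) :
    Tendsto (fun T : ℝ => (2 * π * T) ^ ((d : ℝ) / 2) * heatK d (T - s) x) atTop (nhds 1) := by
  have h0 : Tendsto (fun T : ℝ => T - s) atTop atTop := tendsto_atTop_add_const_right _ _ tendsto_id
  have h1 : Tendsto (fun T : ℝ => 1 + s / (T - s)) atTop (nhds (1 + 0)) :=
    tendsto_const_nhds.add (h0.const_div_atTop s)
  have h2 : Tendsto (fun T : ℝ => -‖x‖ ^ 2 / (2 * (T - s))) atTop (nhds 0) :=
    (h0.const_mul_atTop (by norm_num : (0:ℝ) < 2)).const_div_atTop _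
  have h3 := (h1.rpow_const (p := (d : ℝ) / 2) (Or.inl (by norm_num))).mul
    ((Real.continuous_exp.tendsto 0).comp h2)
  simp only [add_zero, Real.one_rpow, Real.exp_zero, mul_one] at h3
  refine h3.congr' ?_
  filter_upwards [eventually_gt_atTop (max 0 s)] with T hT
  have hT0 : 0 < T := (le_max_left _ _).trans_lt hT
  have hTs : 0 < T - s := sub_pos.2 ((le_max_right _ _).trans_lt hT)
  rw [heatK_scaled d T (T - s) hT0 hTs]
  simp only [Function.comp]
  congr 2
  field_simp
  ring

lemma dct {d : ℕ} (hd : 1 ≤ d) (G : ℝ → EE d → ℝ) (hG : Measurable (Function.uncurry G))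
    (K : ℝ) (hK : 0 ≤ K) (p : EE d)
    (hS : ∀ s, 0 < s → s ≤ 1 → ∀ x, |G s x| ≤ K * Real.exp (-(1 / 24) * ‖x - p‖ ^ 2))
    (hL : ∀ s, 1 ≤ s → ∀ x, |G s x| ≤ K / s ^ (d + 1) *
      Real.exp (-(1 / (4 * s)) * ‖x - p‖ ^ 2)) :
    Tendsto (fun T : ℝ => (2 * π * T) ^ ((d : ℝ) / 2) *
      ∫ s in Set.Ioc (0 : ℝ) T, ∫ x : EE d, G s x * heatK d (T - s) x) atTop
      (nhds (∫ s in Set.Ioi (0 : ℝ), ∫ x : EE d, G s x)) := by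
  set B0 : ℝ → ℝ := fun s => (Set.Ioc (0:ℝ) 1).indicator (fun _ => K * (24 * π) ^ ((d : ℝ) / 2)) s +
    (Set.Ioi (1:ℝ)).indicator (fun s => K * (4 * π) ^ ((d : ℝ) / 2) * s ^ (-(1 + (d : ℝ) / 2))) s
    with hB0
  have hB0S : ∀ s, 0 < s → s ≤ 1 → B0 s = K * (24 * π) ^ ((d : ℝ) / 2) := fun s h1 h2 => by
    simp only [hB0]
    rw [Set.indicator_of_mem (show s ∈ Set.Ioc (0:ℝ) 1 from ⟨h1, h2⟩),
      Set.indicator_of_notMem (by simpa using h2), add_zero]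
  have hB0L : ∀ s, 1 < s → B0 s = K * (4 * π) ^ ((d : ℝ) / 2) * s ^ (-(1 + (d : ℝ) / 2)) :=
    fun s h1 => by
    simp only [hB0]
    rw [Set.indicator_of_notMem (fun h => absurd h.2 (not_le.2 h1)),
      Set.indicator_of_mem (show s ∈ Set.Ioi (1:ℝ) from h1), zero_add]
  have hB0n : ∀ s, 0 < s → 0 ≤ B0 s := fun s hs => by
    rcases le_or_gt s 1 with h | h
    · rw [hB0S s hs h]; positivity
    · rw [hB0L s h]; positivity
  have hB0i : Integrable B0 := by
    refine Integrable.add ?_ ?_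
    · rw [integrable_indicator_iff measurableSet_Ioc]
      exact integrableOn_const (by simp)
    · rw [integrable_indicator_iff measurableSet_Ioi]
      refine Integrable.const_mul ?_ _
      refine integrableOn_Ioi_rpow_of_lt ?_ one_pos
      have : (1:ℝ) ≤ d := by exact_mod_cast hd
      linarith
  have hGm : ∀ s, Measurable (G s) := fun s => hG.comp (measurable_const.prodMk measurable_id)
  have gi : ∀ a : ℝ, 0 < a → Integrable (fun x : EE d => Real.exp (-a * ‖x - p‖ ^ 2)) ∧
      ∫ x : EE d, Real.exp (-a * ‖x - p‖ ^ 2) = (π / a) ^ ((d : ℝ) / 2) := fun a ha => by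
    have := gint a ha p
    simp_rw [norm_sub_rev p] at this
    exact this
  have hspow : ∀ s : ℝ, 0 < s → s ^ ((d : ℝ) / 2) / s ^ (d + 1) = s ^ (-(1 + (d : ℝ) / 2)) := by
    intro s hs
    rw [← Real.rpow_natCast, ← Real.rpow_sub hs]
    congr 1; push_cast; ring
  have hI : ∀ s, 0 < s → Integrable (G s) ∧ ∫ x, |G s x| ≤ B0 s := by
    intro s hs
    rcases le_or_gt s 1 with h | h
    · obtain ⟨i1, v1⟩ := gi (1 / 24) (by norm_num)
      have hint : Integrable (G s) := (i1.const_mul K).mono' (hGm s).aestronglyMeasurable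
        (Eventually.of_forall (hS s hs h))
      refine ⟨hint, ?_⟩
      rw [hB0S s hs h]
      refine (integral_mono hint.abs (i1.const_mul K) (hS s hs h)).trans_eq ?_
      rw [integral_const_mul, v1]
      congr 2; ring
    · obtain ⟨i1, v1⟩ := gi (1 / (4 * s)) (by positivity)
      have hint : Integrable (G s) := (i1.const_mul (K / s ^ (d + 1))).mono'
        (hGm s).aestronglyMeasurable (Eventually.of_forall (hL s h.le))
      refine ⟨hint, ?_⟩
      rw [hB0L s h]
      refine (integral_mono hint.abs (i1.const_mul _) (hL s h.le)).trans_eq ?_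
      rw [integral_const_mul, v1, show π / (1 / (4 * s)) = 4 * π * s by field_simp,
        Real.mul_rpow (by positivity) hs.le, ← hspow s hs]
      ring
  have hheat : ∀ T : ℝ, Measurable (Function.uncurry fun (s : ℝ) (x : EE d) => heatK d (T - s) x) := by
    intro T
    unfold heatK Function.uncurry
    fun_prop
  set F : ℝ → ℝ → ℝ := fun T s => (Set.Iio T).indicator
    (fun s => (2 * π * T) ^ ((d : ℝ) / 2) * ∫ x : EE d, G s x * heatK d (T - s) x) s with hF
  have hFeq : ∀ T, (2 * π * T) ^ ((d : ℝ) / 2) *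
      ∫ s in Set.Ioc (0 : ℝ) T, ∫ x : EE d, G s x * heatK d (T - s) x = ∫ s in Set.Ioi 0, F T s := by
    intro T
    rw [setIntegral_indicator measurableSet_Iio, integral_Ioc_eq_integral_Ioo, integral_const_mul]
    rfl
  simp_rw [hFeq]
  refine tendsto_integral_filter_of_dominated_convergence (fun s => 2 ^ ((d : ℝ) / 2) * B0 s)
    ?_ ?_ (hB0i.const_mul _).integrableOn ?_
  · refine Eventually.of_forall fun T => ?_
    have : StronglyMeasurable fun s => ∫ x : EE d, G s x * heatK d (T - s) x := by
      refine StronglyMeasurable.integral_prod_right (f := fun s x => G s x * heatK d (T - s) x) ?_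
      exact (hG.mul (hheat T)).stronglyMeasurable
    exact ((this.const_mul _).indicator measurableSet_Iio).aestronglyMeasurable
  · filter_upwards [eventually_ge_atTop 2] with T hT
    refine (ae_restrict_iff' measurableSet_Ioi).2 (Eventually.of_forall fun s hs => ?_)
    have hs : 0 < s := hs
    have hT0 : 0 < T := by linarith
    have h2 : (1:ℝ) ≤ 2 ^ ((d : ℝ) / 2) := Real.one_le_rpow (by norm_num) (by positivity)
    simp only [hF]
    by_cases hsT : s < T
    swap
    · rw [Set.indicator_of_notMem (by simpa using hsT), norm_zero]
      have := hB0n s hs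
      positivity
    rw [Set.indicator_of_mem (show s ∈ Set.Iio T from hsT)]
    have hts : 0 < T - s := by linarith
    obtain ⟨hint, hle⟩ := hI s hs
    rcases le_or_gt (2 * s) T with hc | hc
    · rw [← integral_const_mul]
      refine (norm_integral_le_of_norm_le (hint.abs.const_mul (2 ^ ((d : ℝ) / 2)))
        (Eventually.of_forall fun x => ?_)).trans ?_
      · rw [show (2 * π * T) ^ ((d : ℝ) / 2) * (G s x * heatK d (T - s) x) =
          ((2 * π * T) ^ ((d : ℝ) / 2) * heatK d (T - s) x) * G s x by ring, norm_mul,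
          Real.norm_eq_abs (G s x), Real.norm_of_nonneg
            (mul_nonneg (by positivity) (heatK_nonneg d _ hts x))]
        exact mul_le_mul_of_nonneg_right (heatK_scaled_le d T s hs hc x) (abs_nonneg _)
      · rw [integral_const_mul]
        gcongr
    · have hs1 : 1 < s := by linarith
      obtain ⟨i1, v1⟩ := heatK_int d (T - s) hts
      have hb : ‖∫ x : EE d, G s x * heatK d (T - s) x‖ ≤ K / s ^ (d + 1) := by
        refine (norm_integral_le_of_norm_le (i1.const_mul (K / s ^ (d + 1)))
          (Eventually.of_forall fun x => ?_)).trans_eq ?_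
        · rw [norm_mul, Real.norm_of_nonneg (heatK_nonneg d _ hts x)]
          refine mul_le_mul_of_nonneg_right ?_ (heatK_nonneg d _ hts x)
          refine (hL s hs1.le x).trans (mul_le_of_le_one_right (by positivity) ?_)
          rw [Real.exp_le_one_iff]
          have : 0 ≤ 1 / (4 * s) * ‖x - p‖ ^ 2 := by positivity
          linarith
        · rw [integral_const_mul, v1, mul_one]
      rw [norm_mul, Real.norm_of_nonneg (by positivity)]
      calc _ ≤ (4 * π * s) ^ ((d : ℝ) / 2) * (K / s ^ (d + 1)) := by
            refine mul_le_mul (Real.rpow_le_rpow (by positivity) ?_ (by positivity)) hb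
              (norm_nonneg _) (by positivity)
            nlinarith [Real.pi_pos]
        _ = B0 s := by
            rw [hB0L s hs1, ← hspow s hs, Real.mul_rpow (by positivity) hs.le]; ring
        _ ≤ _ := le_mul_of_one_le_left (hB0n s hs) h2
  · refine (ae_restrict_iff' measurableSet_Ioi).2 (Eventually.of_forall fun s hs => ?_)
    have hs : 0 < s := hs
    obtain ⟨hint, -⟩ := hI s hs
    have hlim : Tendsto (fun T : ℝ => ∫ x : EE d, G s x * ((2 * π * T) ^ ((d : ℝ) / 2) *
        heatK d (T - s) x)) atTop (nhds (∫ x, G s x)) := by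
      refine tendsto_integral_filter_of_dominated_convergence
        (fun x => |G s x| * 2 ^ ((d : ℝ) / 2)) ?_ ?_ (hint.abs.mul_const _) ?_
      · refine Eventually.of_forall fun T => ?_
        have hm : Measurable fun x : EE d => heatK d (T - s) x :=
          (hheat T).comp (measurable_const.prodMk measurable_id)
        exact ((hGm s).mul (hm.const_mul _)).aestronglyMeasurable
      · filter_upwards [eventually_ge_atTop (2 * s)] with T hT
        refine Eventually.of_forall fun x => ?_
        rw [norm_mul, Real.norm_eq_abs (G s x), Real.norm_of_nonneg
            (mul_nonneg (Real.rpow_nonneg (by nlinarith [Real.pi_pos]) _)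
              (heatK_nonneg d _ (by linarith) x))]
        exact mul_le_mul_of_nonneg_left (heatK_scaled_le d T s hs hT x) (abs_nonneg _)
      · refine Eventually.of_forall fun x => ?_
        simpa using (heatK_scaled_tendsto d s x).const_mul (G s x)
    refine hlim.congr' ?_
    filter_upwards [eventually_gt_atTop s] with T hT
    simp only [hF]
    rw [Set.indicator_of_mem (show s ∈ Set.Iio T from hT), ← integral_const_mul]
    congr 1; funext x; ring

lemma ew_meas {d : ℕ} (k : ZLat d) : Measurable fun q : ℝ × EE d => ew q.1 q.2 k := by
  unfold ew; fun_prop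

lemma ZZ_meas {d : ℕ} : Measurable fun q : ℝ × EE d => ZZ q.1 q.2 := by
  unfold ZZ; exact Measurable.tsum fun k => ew_meas k

lemma DD_meas {d : ℕ} (m : ZLat d) (i : Fin d) :
    Measurable fun q : ℝ × EE d => DD q.1 q.2 m i := by
  unfold DD
  refine ((measurable_const.div measurable_fst).mul ((ew_meas m).div ZZ_meas)).mul ?_
  exact Measurable.tsum fun k => ((ew_meas k).div ZZ_meas).mul measurable_const

lemma pHeatK_meas_s7 {d : ℕ} : Measurable fun q : ℝ × EE d => pHeatK d q.1 q.2 := by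
  simp_rw [pHeatK_eq_s7]
  refine Measurable.mul ?_ ZZ_meas
  fun_prop

theorem stmt7 (d : ℕ) (hd : 1 ≤ d)
    (A : EuclideanSpace ℝ (Fin d) → ℝ → Matrix (Fin d) (Fin d) ℝ)
    (hmeas : ∀ i i' : Fin d, Measurable fun q : EuclideanSpace ℝ (Fin d) × ℝ => A q.1 q.2 i i')
    (hbdd : ∃ C : ℝ, ∀ (x : EuclideanSpace ℝ (Fin d)) (s : ℝ) (v : Fin d → ℝ),
      Real.sqrt (∑ i, ((A x s).mulVec v i) ^ 2) ≤ C * Real.sqrt (∑ i, (v i) ^ 2))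
    (m n : ZLat d) :
    Filter.Tendsto
      (fun T : ℝ => (2 * π * T) ^ ((d : ℝ) / 2) *
        ∫ s in Set.Ioc (0 : ℝ) T, ∫ x : EuclideanSpace ℝ (Fin d),
          (∑ i, ∑ i',
            pderiv i (fun y => heatK d s (y - latVec m) / pHeatK d s y) x * A x s i i' *
              pderiv i' (fun y => heatK d s (y - latVec n) / pHeatK d s y) x) *
            (heatK d (T - s) x * pHeatK d s x))
      Filter.atTop
      (nhds (∫ s in Set.Ioi (0 : ℝ), ∫ x : EuclideanSpace ℝ (Fin d),
        pHeatK d s x *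
          ∑ i, ∑ i',
            pderiv i (fun y => heatK d s (y - latVec m) / pHeatK d s y) x * A x s i i' *
              pderiv i' (fun y => heatK d s (y - latVec n) / pHeatK d s y) x)) := by
  obtain ⟨C, hC⟩ := hbdd
  have hA : ∀ x s i i', |A x s i i'| ≤ C := by
    intro x s i i'
    have h := hC x s (Pi.single i' 1)
    have e : ∑ j, ((Pi.single i' (1:ℝ) : Fin d → ℝ) j) ^ 2 = 1 := by
      rw [Finset.sum_eq_single i'] <;> simp +contextual [Pi.single_apply]
    rw [e, Real.sqrt_one, mul_one] at h
    refine le_trans ?_ h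
    refine Real.abs_le_sqrt ?_
    have := Finset.single_le_sum (f := fun j => ((A x s).mulVec (Pi.single i' 1) j) ^ 2)
      (fun j _ => sq_nonneg _) (Finset.mem_univ i)
    simpa using this
  have hC0 : 0 ≤ C := (abs_nonneg _).trans (hA 0 0 ⟨0, hd⟩ ⟨0, hd⟩)
  set Q : ℝ → EE d → ℝ := fun s x => ∑ i, ∑ i', DD s x m i * A x s i i' * DD s x n i' with hQ
  have hQb : ∀ s, 0 < s → ∀ x, |Q s x| ≤ (d * d * C) * (RR s x m * RR s x n) := by
    intro s hs x
    calc |Q s x| ≤ ∑ i : Fin d, ∑ i' : Fin d, RR s x m * C * RR s x n := by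
          refine (Finset.abs_sum_le_sum_abs _ _).trans (Finset.sum_le_sum fun i _ => ?_)
          refine (Finset.abs_sum_le_sum_abs _ _).trans (Finset.sum_le_sum fun i' _ => ?_)
          rw [abs_mul, abs_mul]
          have h1 := DD_le s hs x m i
          have h2 := DD_le s hs x n i'
          have h3 := hA x s i i'
          have h4 := RR_nonneg s hs x m
          gcongr
      _ = _ := by simp; ring
  obtain ⟨C1, hC1, hl⟩ := GG_large d
  obtain ⟨C2, hC2, hsm⟩ := GG_small m n
  have hGb : ∀ s, 0 < s → ∀ x, |pHeatK d s x * Q s x| ≤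
      (d * d * C) * (pHeatK d s x * (RR s x m * RR s x n)) := by
    intro s hs x
    have := pHeatK_pos_s7 s hs x
    rw [abs_mul, abs_of_pos this]
    calc _ ≤ pHeatK d s x * ((d * d * C) * (RR s x m * RR s x n)) := by
          have := hQb s hs x
          gcongr
      _ = _ := by ring
  have hmain := dct hd (fun s x => pHeatK d s x * Q s x) (by
      refine pHeatK_meas_s7.mul ?_
      refine Finset.measurable_fun_sum _ fun i _ => Finset.measurable_fun_sum _ fun i' _ => ?_
      exact ((DD_meas m i).mul ((hmeas i i').comp measurable_swap)).mul (DD_meas n i'))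
    ((d * d * C) * (C1 + C2)) (by positivity) (latVec m)
    (fun s hs hs1 x => (hGb s hs x).trans (by
      rw [mul_assoc (d * d * C : ℝ)]
      refine mul_le_mul_of_nonneg_left ((hsm s hs hs1 x).trans ?_) (by positivity)
      gcongr
      linarith))
    (fun s hs x => (hGb s (by linarith) x).trans (by
      rw [mul_div_assoc, mul_assoc (d * d * C : ℝ)]
      refine mul_le_mul_of_nonneg_left ((hl s hs x m n).trans ?_) (by positivity)
      have : 0 < s := by linarith
      gcongr
      linarith))
  have hQe : ∀ s, 0 < s → ∀ x : EE d, (∑ i, ∑ i',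
            pderiv i (fun y => heatK d s (y - latVec m) / pHeatK d s y) x * A x s i i' *
              pderiv i' (fun y => heatK d s (y - latVec n) / pHeatK d s y) x) = Q s x := by
    intro s hs x
    simp only [hQ]
    refine Finset.sum_congr rfl fun i _ => Finset.sum_congr rfl fun i' _ => ?_
    rw [pderiv_eq s hs, pderiv_eq s hs]
  have e2 : (∫ s in Set.Ioi (0 : ℝ), ∫ x : EuclideanSpace ℝ (Fin d),
        pHeatK d s x *
          ∑ i, ∑ i',
            pderiv i (fun y => heatK d s (y - latVec m) / pHeatK d s y) x * A x s i i' *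
              pderiv i' (fun y => heatK d s (y - latVec n) / pHeatK d s y) x) =
      ∫ s in Set.Ioi (0 : ℝ), ∫ x : EE d, pHeatK d s x * Q s x := by
    refine setIntegral_congr_fun measurableSet_Ioi fun s hs => ?_
    simp only [hQe s hs]
  rw [e2]
  refine hmain.congr fun T => ?_
  congr 1
  refine setIntegral_congr_fun measurableSet_Ioc fun s hs => ?_
  simp only [hQe s hs.1]
  congr 1; funext x; ring

end
end

section
/- Let d ≥ 2. There exist constants C₁, C₂, C₃, C₄ > 0 depending only on d such that: (i) |U(m) + 1| ≤ C₂/|m| for all m ∈ ℤ^d with |m| > C₁; and (ii) C₃ ≤ |U(m)| ≤ C₄ for all m ∈ ℤ^d \ {0}. -/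
open MeasureTheory Real Filter

noncomputable section

/-- The function U(x), extended to real arguments. -/
def Ufun (d : ℕ) (x : EuclideanSpace ℝ (Fin d)) : ℝ :=
  -(π ^ ((d : ℝ) / 2) * Real.Gamma (((d : ℝ) + 2) / 2))⁻¹ *
    ∫ s in Set.Ioi (0 : ℝ), ∫ z : EuclideanSpace ℝ (Fin d),
      s ^ ((d : ℝ) / 2) * Real.exp (-s - ‖z‖ ^ 2) /
        pHeatK d (‖x‖ ^ 2 / (4 * s)) ((‖x‖ / (2 * Real.sqrt s)) • z + (2 : ℝ)⁻¹ • x)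


lemma gauss_summable (t : ℝ) (ht : 0 < t) (y : ℝ) :
    Summable fun n : ℤ => rexp (-(y - n)^2 / (2*t)) := by
  have h := (summable_jacobiTheta₂_term_iff (-(y / (2*π*t) : ℝ) * Complex.I)
    ((1 / (2*π*t) : ℝ) * Complex.I)).2 (by simp; positivity)
  have h2 := h.norm.mul_left (rexp (-y^2/(2*t)))
  refine h2.congr fun n => ?_
  rw [norm_jacobiTheta₂_term, ← Real.exp_add]
  congr 1
  simp only [Complex.neg_im, Complex.mul_im, neg_mul, Complex.ofReal_re, Complex.ofReal_im, Complex.I_re, Complex.I_im]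
  have := Real.pi_ne_zero
  field_simp
  ring

lemma theta_bound (t : ℝ) (ht : 1 ≤ t) (y : ℝ) :
    |(2*π*t)^(-(1:ℝ)/2) * ∑' n : ℤ, rexp (-(y - n)^2 / (2*t)) - 1| ≤ 1/(2*t) := by
  have hpi := Real.pi_gt_three
  have ha : 0 < 2*π*t := by positivity
  have key := Complex.tsum_exp_neg_quadratic (a := ((2*π*t : ℝ) : ℂ)) (by simpa using ha)
    (Complex.I * y)
  have e1 : ((1:ℂ) / ((2*π*t : ℝ) : ℂ) ^ (1 / 2 : ℂ)) = (((2*π*t)^(-(1:ℝ)/2) : ℝ) : ℂ) := by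
    rw [Complex.ofReal_cpow ha.le, one_div, ← Complex.cpow_neg]
    congr 1
    push_cast; ring
  have e2 : (∑' n : ℤ, Complex.exp (-π / ((2*π*t : ℝ) : ℂ) * (n + Complex.I * (Complex.I * y)) ^ 2))
      = ((∑' n : ℤ, rexp (-(y - n)^2 / (2*t)) : ℝ) : ℂ) := by
    rw [Complex.ofReal_tsum]
    refine tsum_congr fun n => ?_
    rw [Complex.ofReal_exp]
    congr 1
    have : (n + Complex.I * (Complex.I * y)) = (n - y : ℂ) := by
      rw [← mul_assoc, Complex.I_mul_I]; ring
    rw [this]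
    have h1 : (π : ℂ) ≠ 0 := by exact_mod_cast Real.pi_ne_zero
    have h2 : (t : ℂ) ≠ 0 := by exact_mod_cast (by linarith : t ≠ 0)
    push_cast
    field_simp
    ring
  rw [e1, e2, ← Complex.ofReal_mul] at key
  set f : ℤ → ℂ := fun n => Complex.exp (-π * ((2*π*t : ℝ) : ℂ) * n ^ 2 + 2 * π * (Complex.I * y) * n)
    with hf
  set q : ℝ := rexp (-(2*π^2*t)) with hq
  have hq0 : 0 < q := Real.exp_pos _
  have hqt : q ≤ 1 / (18 * t) := by
    rw [hq, Real.exp_neg, one_div]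
    apply inv_anti₀ (by positivity)
    have := Real.add_one_le_exp (2*π^2*t)
    nlinarith [mul_pos (by linarith : (0:ℝ) < t) (by nlinarith : (0:ℝ) < π^2 - 9)]
  have hq1 : q ≤ 1/18 := hqt.trans (by
    apply one_div_le_one_div_of_le <;> linarith)
  have hnorm : ∀ n : ℤ, ‖f n‖ = rexp (-(2*π^2*t) * n^2) := by
    intro n
    rw [hf]
    simp only [Complex.norm_exp]
    congr 1
    have : (-π * ((2*π*t : ℝ) : ℂ) * n ^ 2 + 2 * π * (Complex.I * y) * n : ℂ)
      = ((-(2*π^2*t) * n^2 : ℝ) : ℂ) + ((2*π*y*n : ℝ) : ℂ) * Complex.I := by push_cast; ring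
    rw [this, Complex.add_re, Complex.ofReal_re, Complex.re_ofReal_mul, Complex.I_re]; ring
  have hgeo : HasSum (fun n : ℕ => q * q^n) (q * (1-q)⁻¹) :=
    (hasSum_geometric_of_lt_one hq0.le (by linarith)).mul_left q
  have hb : ∀ (n : ℕ) (k : ℤ), k^2 = ((n:ℤ)+1)^2 → ‖f k‖ ≤ q * q^n := by
    intro n k hk
    rw [hnorm, ← pow_succ', hq, ← Real.exp_nat_mul]
    apply Real.exp_le_exp.2
    have : ((k:ℝ))^2 = ((n:ℝ)+1)^2 := by exact_mod_cast hk
    rw [this]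
    push_cast
    have h1 : (0:ℝ) ≤ n := Nat.cast_nonneg n
    have h2 : (0:ℝ) ≤ 2*π^2*t := by positivity
    nlinarith [mul_nonneg h2 (mul_nonneg h1 (by linarith : (0:ℝ) ≤ n+1))]
  have hs1 : ‖∑' n : ℕ, f (n+1)‖ ≤ q * (1-q)⁻¹ :=
    tsum_of_norm_bounded hgeo fun n => hb n _ rfl
  have hs2 : ‖∑' n : ℕ, f (-(n+1))‖ ≤ q * (1-q)⁻¹ :=
    tsum_of_norm_bounded hgeo fun n => hb n _ (by ring)
  have hsum1 : Summable fun n : ℕ => f (n+1) :=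
    Summable.of_norm_bounded hgeo.summable fun n => hb n _ rfl
  have hsum2 : Summable fun n : ℕ => f (-(n+1)) :=
    Summable.of_norm_bounded hgeo.summable fun n => hb n _ (by ring)
  have hsplit := tsum_of_add_one_of_neg_add_one hsum1 hsum2
  have hf0 : f 0 = 1 := by simp [hf]
  rw [key, hf0] at hsplit
  rw [← Real.norm_eq_abs, ← Complex.norm_real, Complex.ofReal_sub, Complex.ofReal_one, hsplit]
  have hle : q * (1-q)⁻¹ ≤ 1/(4*t) := by
    rw [← div_eq_mul_inv, div_le_iff₀ (by linarith)]
    have : 1/(18*t) ≤ 1/(4*t) * (17/18) := by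
      field_simp; norm_num
    have h3: 1/(4*t) * (17/18) ≤ 1/(4*t) * (1-q) := by
      gcongr; linarith
    linarith
  calc _ = ‖(∑' n : ℕ, f (n+1)) + ∑' n : ℕ, f (-(n+1))‖ := by congr 1; ring
    _ ≤ 1/(4*t) + 1/(4*t) := (norm_add_le _ _).trans (by linarith)
    _ = _ := by field_simp; norm_num

lemma hasSum_mul_aux {α β : Type} {f : α → ℝ} {g : β → ℝ} {a b : ℝ} (hf : HasSum f a)
    (hg : HasSum g b) (hf0 : ∀ x, 0 ≤ f x) (hg0 : ∀ x, 0 ≤ g x) :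
    HasSum (fun x : α × β => f x.1 * g x.2) (a * b) :=
  HasSum.mul hf hg (Summable.mul_of_nonneg hf.summable hg.summable hf0 hg0)

lemma hasSum_pi_prod : ∀ (d : ℕ) (f : Fin d → ℤ → ℝ) (a : Fin d → ℝ) (_ : ∀ i n, 0 ≤ f i n)
    (_ : ∀ i, HasSum (f i) (a i)), HasSum (fun n : Fin d → ℤ => ∏ i, f i (n i)) (∏ i, a i) := by
  intro d
  induction d with
  | zero => intro f a _ _; simp
  | succ d ih =>
    intro f a h0 h
    have h1 := ih (fun i => f i.succ) (fun i => a i.succ) (fun i n => h0 _ _) (fun i => h _)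
    have h4 : ∀ n : Fin d → ℤ, 0 ≤ ∏ i, f i.succ (n i) :=
      fun n => Finset.prod_nonneg fun i _ => h0 _ _
    have h2 := hasSum_mul_aux (h 0) h1 (h0 0) h4
    rw [← (Fin.consEquiv (fun _ : Fin (d+1) => ℤ)).hasSum_iff, Fin.prod_univ_succ]
    convert h2 using 1
    funext p
    simp [Fin.prod_univ_succ, Fin.consEquiv]

lemma heatK_prod (d : ℕ) (t : ℝ) (ht : 0 < t) (x : EuclideanSpace ℝ (Fin d)) (n : ZLat d) :
    heatK d t (x - latVec n) =
      ∏ i, ((2*π*t)^(-(1:ℝ)/2) * rexp (-(x i - n i)^2 / (2*t))) := by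
  rw [heatK, Finset.prod_mul_distrib, ← Real.exp_sum, Finset.prod_const, Finset.card_univ,
    Fintype.card_fin, ← Real.rpow_mul_natCast (by positivity), EuclideanSpace.real_norm_sq_eq]
  congr 1
  · congr 1; ring
  · rw [← Finset.sum_div, Finset.sum_neg_distrib]
    simp [latVec]

lemma pHeatK_hasSum (d : ℕ) (t : ℝ) (ht : 0 < t) (x : EuclideanSpace ℝ (Fin d)) :
    HasSum (fun n : ZLat d => heatK d t (x - latVec n))
      (∏ i, ((2*π*t)^(-(1:ℝ)/2) * ∑' n : ℤ, rexp (-(x i - n)^2 / (2*t)))) := by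
  simp_rw [heatK_prod d t ht]
  exact hasSum_pi_prod d (fun i n => (2*π*t)^(-(1:ℝ)/2) * rexp (-(x i - n)^2 / (2*t))) _
    (fun i n => by positivity) (fun i => (gauss_summable t ht (x i)).hasSum.mul_left _)

lemma pHeatK_large_s11 (d : ℕ) (t : ℝ) (ht : 1 ≤ t) (x : EuclideanSpace ℝ (Fin d)) :
    (1/2:ℝ)^d ≤ pHeatK d t x ∧ pHeatK d t x ≤ 2^d ∧ |pHeatK d t x - 1| ≤ d * rexp d / t := by
  have ht0 : 0 < t := by linarith
  rw [pHeatK, (pHeatK_hasSum d t ht0 x).tsum_eq]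
  set θ : Fin d → ℝ := fun i => (2*π*t)^(-(1:ℝ)/2) * ∑' n : ℤ, rexp (-(x i - n)^2 / (2*t)) with hθ
  have hb : ∀ i, |θ i - 1| ≤ 1/(2*t) := fun i => theta_bound t ht (x i)
  have ht2 : 1/(2*t) ≤ 1/2 := by
    apply one_div_le_one_div_of_le <;> linarith
  have hb' : ∀ i, 1/2 ≤ θ i ∧ θ i ≤ 2 := fun i => by
    have := abs_le.1 ((hb i).trans ht2)
    constructor <;> linarith
  refine ⟨?_, ?_, ?_⟩
  · calc (1/2:ℝ)^d = ∏ i : Fin d, (1/2:ℝ) := by simp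
      _ ≤ _ := Finset.prod_le_prod (fun _ _ => by norm_num) (fun i _ => (hb' i).1)
  · calc _ ≤ ∏ i : Fin d, (2:ℝ) :=
          Finset.prod_le_prod (fun i _ => by have := (hb' i).1; change 0 ≤ θ i; linarith)
            (fun i _ => (hb' i).2)
      _ = _ := by simp
  · have h := Finset.norm_prod_one_add_sub_one_le Finset.univ (fun i => θ i - 1)
    simp only [add_sub_cancel, Real.norm_eq_abs] at h
    refine h.trans ?_
    set S := ∑ i, |θ i - 1| with hS
    have hS0 : 0 ≤ S := Finset.sum_nonneg fun i _ => abs_nonneg _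
    have hS1 : S ≤ d * (1/(2*t)) := by
      calc S ≤ ∑ i : Fin d, 1/(2*t) := Finset.sum_le_sum fun i _ => hb i
        _ = _ := by simp
    have hS2 : S ≤ d / t := hS1.trans (by
      rw [mul_one_div]
      gcongr
      linarith)
    have hS3 : S ≤ d := hS2.trans (div_le_self (Nat.cast_nonneg d) ht)
    have h3 : rexp S - 1 ≤ S * rexp S := by
      have := Real.add_one_le_exp (-S)
      have h4 : rexp (-S) * rexp S = 1 := by rw [← Real.exp_add]; simp
      nlinarith [Real.exp_pos S]
    calc rexp S - 1 ≤ S * rexp S := h3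
      _ ≤ d / t * rexp d := by gcongr
      _ = _ := by ring

lemma pHeatK_amgm (d : ℕ) (t : ℝ) (ht : 0 < t) (v : EuclideanSpace ℝ (Fin d)) (m : ZLat d)
    (hm : m ≠ 0) :
    (2*π*t)^(-(d:ℝ)/2) * rexp (-(‖v‖^2/(2*t) + ‖latVec m‖^2/(8*t))) ≤
      pHeatK d t (v + (2:ℝ)⁻¹ • latVec m) := by
  have hs := (pHeatK_hasSum d t ht (v + (2:ℝ)⁻¹ • latVec m)).summable
  have h1 := hs.sum_le_tsum {0, m} (fun n _ => by rw [heatK]; positivity)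
  rw [Finset.sum_pair hm.symm] at h1
  rw [pHeatK]
  refine le_trans ?_ h1
  have e0 : v + (2:ℝ)⁻¹ • latVec m - latVec 0 = v + (2:ℝ)⁻¹ • latVec m := by
    have : latVec (0 : ZLat d) = 0 := by ext i; simp [latVec]
    rw [this, sub_zero]
  have e1 : v + (2:ℝ)⁻¹ • latVec m - latVec m = v - (2:ℝ)⁻¹ • latVec m := by
    module
  rw [e0, e1, heatK, heatK, ← mul_add]
  apply mul_le_mul_of_nonneg_left _ (by positivity)
  set w := (2:ℝ)⁻¹ • latVec m with hw
  have hwn : ‖latVec m‖ = 2 * ‖w‖ := by rw [hw, norm_smul]; norm_num; ring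
  have hp := parallelogram_law_with_norm ℝ v w
  set a := -‖v + w‖^2/(2*t)
  set b := -‖v - w‖^2/(2*t)
  have hab : -(‖v‖^2/(2*t) + ‖latVec m‖^2/(8*t)) = a/2 + b/2 := by
    rw [hwn]
    simp only [a, b]
    field_simp
    nlinarith [hp]
  have ha : rexp a = rexp (a/2) * rexp (a/2) := by rw [← Real.exp_add]; ring_nf
  have hb : rexp b = rexp (b/2) * rexp (b/2) := by rw [← Real.exp_add]; ring_nf
  rw [hab, Real.exp_add, ha, hb]
  nlinarith [sq_nonneg (rexp (a/2) - rexp (b/2)), Real.exp_pos (a/2), Real.exp_pos (b/2),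
    mul_pos (Real.exp_pos (a/2)) (Real.exp_pos (b/2))]

lemma latVec_norm (d : ℕ) (m : ZLat d) (hm : m ≠ 0) : 1 ≤ ‖latVec m‖ := by
  obtain ⟨i, hi⟩ := Function.ne_iff.1 hm
  have h1 : (1:ℝ) ≤ |(m i : ℝ)| := by exact_mod_cast Int.one_le_abs hi
  refine h1.trans ?_
  have := PiLp.norm_apply_le (latVec m) i
  simpa [latVec] using this

/-- The kernel occurring in `Ufun`. -/
def Hker (d : ℕ) (x : EuclideanSpace ℝ (Fin d)) (s : ℝ) (z : EuclideanSpace ℝ (Fin d)) : ℝ :=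
  pHeatK d (‖x‖ ^ 2 / (4 * s)) ((‖x‖ / (2 * Real.sqrt s)) • z + (2 : ℝ)⁻¹ • x)

lemma Hker_bounds (d : ℕ) : ∃ C : ℝ, 0 < C ∧ ∀ m : ZLat d, m ≠ 0 → ∀ s : ℝ, 0 < s →
    ∀ z : EuclideanSpace ℝ (Fin d), 0 < Hker d (latVec m) s z ∧
      |(Hker d (latVec m) s z)⁻¹ - 1| ≤ C * s / ‖latVec m‖^2 * rexp ((s + ‖z‖^2)/2) ∧
      (s ≤ 1/4 → Hker d (latVec m) s z ≤ 2^d) := by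
  set A : ℝ := 4 * (2^d * (d * rexp d)) with hA
  set B : ℝ := 4 * ((2*π)^((d:ℝ)/2) + 1) with hB
  have hA0 : 0 ≤ A := by positivity
  have hB0 : 0 < B := by positivity
  refine ⟨A + B, by positivity, fun m hm s hs z => ?_⟩
  set r := ‖latVec m‖ with hr
  have hr1 : 1 ≤ r := latVec_norm d m hm
  have hr0 : 0 < r := by linarith
  set t := r^2/(4*s) with ht
  have ht0 : 0 < t := by positivity
  have hE : 1 ≤ rexp ((s + ‖z‖^2)/2) := Real.one_le_exp (by positivity)
  have hst : s / r^2 = 1/(4*t) := by rw [ht]; field_simp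
  have hlow := pHeatK_amgm d t ht0 ((r / (2 * Real.sqrt s)) • z) m hm
  have hpos : 0 < Hker d (latVec m) s z := lt_of_lt_of_le (by positivity) hlow
  refine ⟨hpos, ?_, ?_⟩
  · rcases le_total 1 t with h1 | h1
    · obtain ⟨b1, b2, b3⟩ := pHeatK_large_s11 d t h1 ((r / (2 * Real.sqrt s)) • z + (2:ℝ)⁻¹ • latVec m)
      change _ ≤ Hker d (latVec m) s z at b1
      change |Hker d (latVec m) s z - 1| ≤ _ at b3
      set H := Hker d (latVec m) s z
      have hinv : H⁻¹ ≤ 2^d := by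
        calc H⁻¹ ≤ ((1/2:ℝ)^d)⁻¹ := inv_anti₀ (by positivity) b1
          _ = 2^d := by rw [one_div, inv_pow, inv_inv]
      have : H⁻¹ - 1 = -(H⁻¹ * (H - 1)) := by field_simp; ring
      rw [this, abs_neg, abs_mul, abs_of_pos (inv_pos.2 hpos)]
      calc H⁻¹ * |H - 1| ≤ 2^d * (d * rexp d / t) := by gcongr
        _ = A * (s / r^2) := by rw [hst, hA]; field_simp
        _ ≤ (A + B) * (s / r^2) := by gcongr; linarith
        _ ≤ (A + B) * (s / r^2) * rexp ((s + ‖z‖^2)/2) := le_mul_of_one_le_right (by positivity) hE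
        _ = _ := by ring
    · have hexp : -(‖(r / (2 * Real.sqrt s)) • z‖^2/(2*t) + ‖latVec m‖^2/(8*t))
          = -((s + ‖z‖^2)/2) := by
        rw [norm_smul, mul_pow, Real.norm_eq_abs, sq_abs, div_pow, mul_pow, Real.sq_sqrt hs.le,
          ← hr, ht]
        field_simp
        ring
      rw [hexp] at hlow
      change _ ≤ Hker d (latVec m) s z at hlow
      set H := Hker d (latVec m) s z
      have hinv : H⁻¹ ≤ (2*π)^((d:ℝ)/2) * rexp ((s + ‖z‖^2)/2) := by
        calc H⁻¹ ≤ ((2*π*t)^(-(d:ℝ)/2) * rexp (-((s + ‖z‖^2)/2)))⁻¹ := inv_anti₀ (by positivity) hlow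
          _ = (2*π*t)^((d:ℝ)/2) * rexp ((s + ‖z‖^2)/2) := by
            rw [mul_inv, Real.exp_neg, inv_inv, neg_div, Real.rpow_neg (by positivity), inv_inv]
          _ ≤ _ := by
            refine mul_le_mul_of_nonneg_right (Real.rpow_le_rpow (by positivity) ?_ (by positivity))
              (Real.exp_pos _).le
            nlinarith [Real.pi_pos]
      have hs4 : 1 ≤ 4 * (s / r^2) := by
        rw [hst]
        rw [mul_one_div, le_div_iff₀ (by positivity)]
        linarith
      have habs : |H⁻¹ - 1| ≤ H⁻¹ + 1 := by
        have := inv_pos.2 hpos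
        rw [abs_le]; constructor <;> linarith
      calc |H⁻¹ - 1| ≤ (2*π)^((d:ℝ)/2) * rexp ((s + ‖z‖^2)/2) + rexp ((s + ‖z‖^2)/2) := by linarith
        _ = ((2*π)^((d:ℝ)/2) + 1) * rexp ((s + ‖z‖^2)/2) * 1 := by ring
        _ ≤ ((2*π)^((d:ℝ)/2) + 1) * rexp ((s + ‖z‖^2)/2) * (4 * (s / r^2)) := by gcongr
        _ = B * (s / r^2) * rexp ((s + ‖z‖^2)/2) := by rw [hB]; ring
        _ ≤ (A + B) * (s / r^2) * rexp ((s + ‖z‖^2)/2) := by gcongr; linarith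
        _ = _ := by ring
  · intro hs4
    have h1 : 1 ≤ t := by
      rw [ht, le_div_iff₀ (by positivity)]
      nlinarith
    exact (pHeatK_large_s11 d t h1 _).2.1

lemma Hker_measurable (d : ℕ) (x : EuclideanSpace ℝ (Fin d)) :
    Measurable (fun p : ℝ × EuclideanSpace ℝ (Fin d) => Hker d x p.1 p.2) := by
  unfold Hker pHeatK heatK
  refine Measurable.tsum fun n => ?_
  fun_prop

lemma gauss_int (d : ℕ) (b : ℝ) (hb : 0 < b) :
    Integrable (fun z : EuclideanSpace ℝ (Fin d) => rexp (-b * ‖z‖^2)) := by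
  have h := (GaussianFourier.integrable_cexp_neg_mul_sq_norm_add (V := EuclideanSpace ℝ (Fin d))
    (b := (b:ℂ)) (by simpa using hb) 0 0).norm
  refine h.congr (Eventually.of_forall fun z => ?_)
  simp only [Complex.norm_exp]
  congr 1
  have : (-(b:ℂ) * (‖z‖:ℂ)^2 + 0 * ((inner ℝ (0 : EuclideanSpace ℝ (Fin d)) z : ℝ) : ℂ))
    = ((-b * ‖z‖^2 : ℝ) : ℂ) := by push_cast; ring
  rw [this, Complex.ofReal_re]

lemma main_est (d : ℕ) : ∃ C₂ C₃ : ℝ, 0 < C₂ ∧ 0 < C₃ ∧ ∀ m : ZLat d, m ≠ 0 →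
    |Ufun d (latVec m) + 1| ≤ C₂ / ‖latVec m‖^2 ∧ C₃ ≤ |Ufun d (latVec m)| := by
  obtain ⟨C, hC, hH⟩ := Hker_bounds d
  set A : ℝ := π ^ ((d : ℝ) / 2) * Real.Gamma (((d : ℝ) + 2) / 2) with hA
  have hG : 0 < Real.Gamma (((d : ℝ) + 2) / 2) := Real.Gamma_pos_of_pos (by positivity)
  have hA0 : 0 < A := by positivity
  set g1 : ℝ := ∫ z : EuclideanSpace ℝ (Fin d), rexp (-1 * ‖z‖^2) with hg1
  set g2 : ℝ := ∫ z : EuclideanSpace ℝ (Fin d), rexp (-(1/2) * ‖z‖^2) with hg2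
  have hg1v : g1 = π ^ ((d:ℝ)/2) := by
    rw [hg1, GaussianFourier.integral_rexp_neg_mul_sq_norm one_pos]; simp
  have hg1p : 0 < g1 := by rw [hg1v]; positivity
  have hg2p : 0 ≤ g2 := integral_nonneg fun z => (Real.exp_pos _).le
  set I0 : ℝ → ℝ := fun s => s^((d:ℝ)/2) * rexp (-s) * g1 with hI0
  set J0 : ℝ → ℝ := fun s => s^((d:ℝ)/2 + 1) * rexp (-(1/2) * s) with hJ0
  have hI0i : IntegrableOn I0 (Set.Ioi 0) := by
    have := (integrableOn_rpow_mul_exp_neg_mul_rpow (p := 1) (s := (d:ℝ)/2) (b := 1)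
      (by have : (0:ℝ) ≤ d := Nat.cast_nonneg d
          linarith) one_pos one_pos).mul_const g1
    simpa [hI0, IntegrableOn] using this
  have hJ0i : IntegrableOn J0 (Set.Ioi 0) := by
    have := (integrableOn_rpow_mul_exp_neg_mul_rpow (p := 1) (s := (d:ℝ)/2+1) (b := 1/2)
      (by have : (0:ℝ) ≤ d := Nat.cast_nonneg d
          linarith) one_pos (by norm_num))
    simpa [hJ0] using this
  set J : ℝ := ∫ s in Set.Ioi (0:ℝ), J0 s with hJ
  have hJp : 0 ≤ J := setIntegral_nonneg measurableSet_Ioi fun s hs => by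
    have : (0:ℝ) < s := hs
    simp only [hJ0]; positivity
  have hI0v : ∫ s in Set.Ioi (0:ℝ), I0 s = A := by
    have := Real.integral_rpow_mul_exp_neg_mul_Ioi (a := ((d:ℝ)+2)/2) (r := 1) (by positivity) one_pos
    simp only [hI0]
    rw [integral_mul_const, hg1v, hA, mul_comm]
    congr 1
    simp only [one_mul, div_one, Real.one_rpow] at this
    rw [← this]
    congr 1
    funext s
    congr 2
    ring
  set L : ℝ := ∫ s in Set.Ioc (0:ℝ) (1/4), I0 s with hL
  have hLp : 0 < L := by
    rw [hL, ← intervalIntegral.integral_of_le (by norm_num)]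
    refine intervalIntegral.intervalIntegral_pos_of_pos_on ?_ ?_ (by norm_num)
    · rw [intervalIntegrable_iff_integrableOn_Ioc_of_le (by norm_num)]
      exact hI0i.mono_set Set.Ioc_subset_Ioi_self
    · intro s hs
      have := hs.1
      simp only [hI0]; positivity
  refine ⟨A⁻¹ * (C * g2 * J) + 1, A⁻¹ * ((2^d)⁻¹ * L), by positivity, by positivity, fun m hm => ?_⟩
  set r := ‖latVec m‖ with hr
  have hr1 : 1 ≤ r := latVec_norm d m hm
  have hr0 : 0 < r := by linarith
  set w : ℝ → EuclideanSpace ℝ (Fin d) → ℝ := fun s z => s^((d:ℝ)/2) * rexp (-s - ‖z‖^2) with hw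
  set F : ℝ → EuclideanSpace ℝ (Fin d) → ℝ := fun s z => w s z / Hker d (latVec m) s z with hF
  have hFm : Measurable (fun p : ℝ × EuclideanSpace ℝ (Fin d) => F p.1 p.2) := by
    refine Measurable.div ?_ (Hker_measurable d _)
    simp only [hw]
    fun_prop
  have hweq : ∀ s z, w s z = s^((d:ℝ)/2) * rexp (-s) * rexp (-1 * ‖z‖^2) := by
    intro s z
    simp only [hw]
    rw [mul_assoc, ← Real.exp_add]
    congr 2; ring
  have hwi : ∀ s, Integrable (w s) := by
    intro s
    refine ((gauss_int d 1 one_pos).const_mul (s^((d:ℝ)/2) * rexp (-s))).congr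
      (Eventually.of_forall fun z => (hweq s z).symm)
  have hwv : ∀ s, ∫ z, w s z = I0 s := by
    intro s
    simp_rw [hweq]
    rw [integral_const_mul]
  have hdiff : ∀ s, 0 < s → ∀ z, |F s z - w s z| ≤ C / r^2 * J0 s * rexp (-(1/2) * ‖z‖^2) := by
    intro s hs z
    obtain ⟨h1, h2, -⟩ := hH m hm s hs z
    have hw0 : 0 ≤ w s z := by simp only [hw]; positivity
    have : F s z - w s z = w s z * ((Hker d (latVec m) s z)⁻¹ - 1) := by
      simp only [hF]; ring
    rw [this, abs_mul, abs_of_nonneg hw0]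
    refine (mul_le_mul_of_nonneg_left h2 hw0).trans (le_of_eq ?_)
    simp only [hw, hJ0]
    rw [Real.rpow_add_one hs.ne']
    have e : rexp (-s - ‖z‖^2) * rexp ((s + ‖z‖^2)/2) = rexp (-(1/2)*s) * rexp (-(1/2) * ‖z‖^2) := by
      rw [← Real.exp_add, ← Real.exp_add]; congr 1; ring
    calc _ = (C * s / r^2) * s^((d:ℝ)/2) * (rexp (-s - ‖z‖^2) * rexp ((s + ‖z‖^2)/2)) := by ring
      _ = _ := by rw [e]; ring
  have hFs : ∀ s, Measurable (F s) := fun s => hFm.comp (measurable_const.prodMk measurable_id)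
  have hDi : ∀ s, 0 < s → Integrable (fun z => F s z - w s z) := by
    intro s hs
    refine Integrable.mono' ((gauss_int d (1/2) (by norm_num)).const_mul (C / r^2 * J0 s))
      ((hFs s).aestronglyMeasurable.sub (hwi s).aestronglyMeasurable)
      (Eventually.of_forall fun z => hdiff s hs z)
  have hFi : ∀ s, 0 < s → Integrable (F s) := by
    intro s hs
    refine ((hDi s hs).add (hwi s)).congr (Eventually.of_forall fun z => ?_)
    simp
  set I : ℝ → ℝ := fun s => ∫ z, F s z with hI
  have hIm : StronglyMeasurable I := hFm.stronglyMeasurable.integral_prod_right'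
  have hIdiff : ∀ s, 0 < s → |I s - I0 s| ≤ C / r^2 * g2 * J0 s := by
    intro s hs
    rw [← hwv s]
    simp only [hI]
    rw [← integral_sub (hFi s hs) (hwi s), ← Real.norm_eq_abs]
    refine (norm_integral_le_of_norm_le
      ((gauss_int d (1/2) (by norm_num)).const_mul (C / r^2 * J0 s))
      (Eventually.of_forall fun z => hdiff s hs z)).trans (le_of_eq ?_)
    rw [integral_const_mul]; ring
  have hDI : IntegrableOn (fun s => I s - I0 s) (Set.Ioi 0) := by
    refine Integrable.mono' (hJ0i.const_mul (C / r^2 * g2))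
      (hIm.aestronglyMeasurable.sub hI0i.aestronglyMeasurable) ?_
    exact (ae_restrict_iff' measurableSet_Ioi).2 (Eventually.of_forall fun s hs => hIdiff s hs)
  have hII : IntegrableOn I (Set.Ioi 0) := by
    refine (hDI.add hI0i).congr (Eventually.of_forall fun z => ?_)
    simp
  have hU : Ufun d (latVec m) = -A⁻¹ * ∫ s in Set.Ioi (0:ℝ), I s := rfl
  have hmain : |(∫ s in Set.Ioi (0:ℝ), I s) - A| ≤ C / r^2 * g2 * J := by
    rw [← hI0v, ← integral_sub hII hI0i, ← Real.norm_eq_abs]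
    refine (norm_integral_le_of_norm_le (hJ0i.const_mul (C / r^2 * g2))
      ((ae_restrict_iff' measurableSet_Ioi).2
        (Eventually.of_forall fun s hs => hIdiff s hs))).trans (le_of_eq ?_)
    rw [integral_const_mul]
  have hF0 : ∀ s, 0 < s → ∀ z, 0 ≤ F s z := fun s hs z => by
    have := (hH m hm s hs z).1
    simp only [hF, hw]; positivity
  have hlow : (2^d)⁻¹ * L ≤ ∫ s in Set.Ioi (0:ℝ), I s := by
    calc (2^d)⁻¹ * L = ∫ s in Set.Ioc (0:ℝ) (1/4), (2^d)⁻¹ * I0 s := by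
          rw [integral_const_mul]
      _ ≤ ∫ s in Set.Ioc (0:ℝ) (1/4), I s := by
          refine setIntegral_mono_on ((hI0i.mono_set Set.Ioc_subset_Ioi_self).const_mul _)
            (hII.mono_set Set.Ioc_subset_Ioi_self) measurableSet_Ioc fun s hs => ?_
          rw [← hwv s, ← integral_const_mul]
          refine integral_mono ((hwi s).const_mul _) (hFi s hs.1) fun z => ?_
          obtain ⟨h1, -, h3⟩ := hH m hm s hs.1 z
          have hs0 := hs.1
          have hw0 : 0 ≤ w s z := by simp only [hw]; positivity
          simp only [hF]
          rw [div_eq_inv_mul]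
          exact mul_le_mul_of_nonneg_right (inv_anti₀ h1 (h3 hs.2)) hw0
      _ ≤ _ := by
          refine setIntegral_mono_set hII ?_ (LE.le.eventuallyLE Set.Ioc_subset_Ioi_self)
          exact (ae_restrict_iff' measurableSet_Ioi).2
            (Eventually.of_forall fun s hs => integral_nonneg fun z => hF0 s hs z)
  constructor
  · have : Ufun d (latVec m) + 1 = -(A⁻¹ * ((∫ s in Set.Ioi (0:ℝ), I s) - A)) := by
      rw [hU]; field_simp; ring
    rw [this, abs_neg, abs_mul, abs_of_pos (inv_pos.2 hA0)]
    calc _ ≤ A⁻¹ * (C / r^2 * g2 * J) := by gcongr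
      _ = (A⁻¹ * (C * g2 * J)) / r^2 := by ring
      _ ≤ _ := by gcongr; linarith
  · have h0 : 0 ≤ ∫ s in Set.Ioi (0:ℝ), I s := le_trans (by positivity) hlow
    rw [hU, abs_mul, abs_neg, abs_of_pos (inv_pos.2 hA0), abs_of_nonneg h0]
    gcongr

theorem stmt11 (d : ℕ) (hd : 2 ≤ d) :
    ∃ C₁ C₂ C₃ C₄ : ℝ, 0 < C₁ ∧ 0 < C₂ ∧ 0 < C₃ ∧ 0 < C₄ ∧
      (∀ m : ZLat d, C₁ < ‖latVec m‖ → |Ufun d (latVec m) + 1| ≤ C₂ / ‖latVec m‖) ∧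
      (∀ m : ZLat d, m ≠ 0 → C₃ ≤ |Ufun d (latVec m)| ∧ |Ufun d (latVec m)| ≤ C₄) := by
  obtain ⟨C₂, C₃, h2, h3, h⟩ := main_est d
  refine ⟨1, C₂, C₃, C₂ + 1, one_pos, h2, h3, by linarith, fun m hm => ?_, fun m hm => ⟨(h m hm).2, ?_⟩⟩
  · have hm0 : m ≠ 0 := by
      rintro rfl
      have : latVec (0 : ZLat d) = 0 := by ext i; simp [latVec]
      rw [this, norm_zero] at hm
      linarith
    refine (h m hm0).1.trans ?_
    have hr := latVec_norm d m hm0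
    gcongr
    nlinarith
  · have hr := latVec_norm d m hm
    have h1 := (h m hm).1
    have h4 : C₂ / ‖latVec m‖^2 ≤ C₂ := div_le_self h2.le (by nlinarith)
    have h5 := abs_le.1 (h1.trans h4)
    rw [abs_le]; constructor <;> linarith

end
end
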